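/- arXiv:1708.02442 — 3 statements merged into one kernel-verified Lean document; each statement's English description precedes it below -/
import Mathlib

section
/- Let K be an infinite field and A ∈ 𝔪·Mat(m,n,R) with n ≤ m a matrix that is finitely G-determined. Then for every t ∈ {1,…,n}, the height of the determinantal ideal I_t(A) in R equals min{s, (m−t+1)(n−t+1)}. -/
noncomputable section

/-- The maximal ideal `𝔪 = ⟨x_1,…,x_s⟩` of `R = K[[x_1,…,x_s]]`. -/
def mIdeal (s : ℕ) (K : Type*) [Field K] : Ideal (MvPowerSeries (Fin s) K) :=
  Ideal.span (Set.range MvPowerSeries.X)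

/-- Left-right (`G`-) equivalence of matrices over `R = K[[x_1,…,x_s]]`:
`B = U · φ(A) · V` for invertible `U`, `V` and a (local) `K`-algebra
automorphism `φ` of `R` applied entrywise. -/
def GEquiv {s : ℕ} {K : Type*} [Field K] {m n : ℕ}
    (A B : Matrix (Fin m) (Fin n) (MvPowerSeries (Fin s) K)) : Prop :=
  ∃ (U : Matrix (Fin m) (Fin m) (MvPowerSeries (Fin s) K))
    (V : Matrix (Fin n) (Fin n) (MvPowerSeries (Fin s) K))
    (φ : MvPowerSeries (Fin s) K ≃ₐ[K] MvPowerSeries (Fin s) K),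
    IsUnit U ∧ IsUnit V ∧ B = U * (A.map φ) * V

/-- A matrix `A` is `G` `k`-determined if every `B` with `B - A ∈ 𝔪^{k+1}·M_{m,n}`
is `G`-equivalent to `A`. -/
def GDetermined {s : ℕ} {K : Type*} [Field K] {m n : ℕ} (k : ℕ)
    (A : Matrix (Fin m) (Fin n) (MvPowerSeries (Fin s) K)) : Prop :=
  ∀ B : Matrix (Fin m) (Fin n) (MvPowerSeries (Fin s) K),
    (∀ i j, B i j - A i j ∈ (mIdeal s K) ^ (k + 1)) → GEquiv A B

/-- A matrix is finitely `G`-determined if it is `G` `k`-determined for some `k`. -/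
def FinitelyGDetermined {s : ℕ} {K : Type*} [Field K] {m n : ℕ}
    (A : Matrix (Fin m) (Fin n) (MvPowerSeries (Fin s) K)) : Prop :=
  ∃ k : ℕ, GDetermined k A

end

noncomputable section

/-- `detIdeal t M` is the ideal `I_t(M)` generated by all `t × t` minors of `M`. -/
def detIdeal {A : Type*} [CommRing A] {m n : ℕ} (t : ℕ)
    (M : Matrix (Fin m) (Fin n) A) : Ideal A :=
  Ideal.span { d | ∃ (f : Fin t → Fin m) (g : Fin t → Fin n), d = (M.submatrix f g).det }

/-- The height of an ideal: the infimum of the heights of the primes containing it. -/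
def idealHeight {A : Type*} [CommRing A] (I : Ideal A) : ℕ∞ :=
  ⨅ (p : PrimeSpectrum A) (_ : I ≤ p.asIdeal), Order.height p


section minors
variable {R : Type*} [CommRing R]

lemma det_mem_detIdeal {m n t : ℕ} (M : Matrix (Fin m) (Fin n) R) (f : Fin t → Fin m)
    (g : Fin t → Fin n) : (M.submatrix f g).det ∈ detIdeal t M :=
  Ideal.subset_span ⟨f, g, rfl⟩

lemma detIdeal_le_iff {m n t : ℕ} (M : Matrix (Fin m) (Fin n) R) (I : Ideal R) :
    detIdeal t M ≤ I ↔ ∀ f g, (M.submatrix (f : Fin t → Fin m) (g : Fin t → Fin n)).det ∈ I := by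
  rw [detIdeal, Ideal.span_le]
  constructor
  · intro h f g
    exact h ⟨f, g, rfl⟩
  · rintro h _ ⟨f, g, rfl⟩
    exact h f g

lemma detIdeal_transpose {m n t : ℕ} (M : Matrix (Fin m) (Fin n) R) :
    detIdeal t M.transpose = detIdeal t M := by
  apply le_antisymm <;> rw [detIdeal_le_iff] <;> intro f g
  · rw [← Matrix.det_transpose]
    exact det_mem_detIdeal M g f
  · rw [← Matrix.det_transpose]
    exact det_mem_detIdeal M.transpose g f

lemma detIdeal_mul_left_le {m m' n t : ℕ} (U : Matrix (Fin m') (Fin m) R)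
    (M : Matrix (Fin m) (Fin n) R) : detIdeal t (U * M) ≤ detIdeal t M := by
  classical
  rw [detIdeal_le_iff]
  intro f g
  have h1 : ((U * M).submatrix f g) =
      fun i => ∑ k : Fin m, U (f i) k • (fun j => M k (g j)) := by
    ext i j
    simp [Matrix.mul_apply, Finset.sum_apply]
  have h2 := (Matrix.detRowAlternating (R := R) (n := Fin t)).toMultilinearMap.map_sum
    (fun i (k : Fin m) => U (f i) k • (fun j => M k (g j)))
  have h3 := (congrArg Matrix.det h1).trans h2
  rw [h3]
  refine Ideal.sum_mem _ fun r _ => ?_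
  rw [MultilinearMap.map_smul_univ]
  rw [smul_eq_mul]
  exact Ideal.mul_mem_left _ _ (det_mem_detIdeal M r g)

lemma detIdeal_mul_right_le {m n n' t : ℕ} (M : Matrix (Fin m) (Fin n) R)
    (V : Matrix (Fin n) (Fin n') R) : detIdeal t (M * V) ≤ detIdeal t M := by
  rw [← detIdeal_transpose, Matrix.transpose_mul, ← detIdeal_transpose M]
  exact detIdeal_mul_left_le _ _

lemma detIdeal_map {S : Type*} [CommRing S] {m n t : ℕ} (M : Matrix (Fin m) (Fin n) R)
    (φ : R →+* S) : detIdeal t (M.map φ) = (detIdeal t M).map φ := by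
  apply le_antisymm
  · rw [detIdeal_le_iff]
    intro f g
    have : ((M.map φ).submatrix f g).det = φ (M.submatrix f g).det := by
      rw [RingHom.map_det]; rfl
    rw [this]
    exact Ideal.mem_map_of_mem _ (det_mem_detIdeal M f g)
  · rw [Ideal.map_le_iff_le_comap, detIdeal_le_iff]
    intro f g
    rw [Ideal.mem_comap, RingHom.map_det]
    exact det_mem_detIdeal (M.map φ) f g

lemma detIdeal_submatrix_le {m n m' n' t : ℕ} (M : Matrix (Fin m) (Fin n) R)
    (e : Fin m' → Fin m) (e' : Fin n' → Fin n) :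
    detIdeal t (M.submatrix e e') ≤ detIdeal t M := by
  rw [detIdeal_le_iff]
  intro f g
  exact det_mem_detIdeal M (e ∘ f) (e' ∘ g)

lemma detIdeal_submatrix_equiv {m n t : ℕ} (M : Matrix (Fin m) (Fin n) R)
    (e : Fin m ≃ Fin m) (e' : Fin n ≃ Fin n) :
    detIdeal t (M.submatrix e e') = detIdeal t M := by
  apply le_antisymm (detIdeal_submatrix_le _ _ _)
  have := detIdeal_submatrix_le (t := t) (M.submatrix e e') e.symm e'.symm
  simpa using this

lemma detIdeal_succ_le {m n t : ℕ} (M : Matrix (Fin m) (Fin n) R) :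
    detIdeal (t + 1) M ≤ detIdeal t M := by
  rw [detIdeal_le_iff]
  intro f g
  rw [Matrix.det_succ_row_zero]
  refine Ideal.sum_mem _ fun j _ => Ideal.mul_mem_left _ _ ?_
  exact det_mem_detIdeal M (f ∘ Fin.succ) (g ∘ j.succAbove)

/-- The first row and column are those of the identity matrix. -/
lemma detIdeal_bordered {m n t : ℕ} (M : Matrix (Fin (m + 1)) (Fin (n + 1)) R)
    (h00 : M 0 0 = 1) (hr : ∀ j : Fin n, M 0 j.succ = 0) (hc : ∀ i : Fin m, M i.succ 0 = 0) :
    detIdeal (t + 1) M = detIdeal t (M.submatrix Fin.succ Fin.succ) := by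
  apply le_antisymm
  · rw [detIdeal_le_iff]
    intro f g
    by_cases hf : Function.Injective f
    swap
    · rw [Function.not_injective_iff] at hf
      obtain ⟨a, b, hab, hne⟩ := hf
      rw [Matrix.det_zero_of_row_eq hne]
      · exact Ideal.zero_mem _
      · ext j; simp [hab]
    by_cases hg : Function.Injective g
    swap
    · rw [Function.not_injective_iff] at hg
      obtain ⟨a, b, hab, hne⟩ := hg
      rw [Matrix.det_zero_of_column_eq hne]
      · exact Ideal.zero_mem _
      · intro j; simp [hab]
    by_cases h0 : ∃ i, f i = 0
    · obtain ⟨i, hi⟩ := h0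
      rw [Matrix.det_succ_row _ i]
      refine Ideal.sum_mem _ fun j _ => ?_
      by_cases hj : g j = 0
      · apply Ideal.mul_mem_left
        have h1 : ∀ k, ∃ l, f (i.succAbove k) = Fin.succ l := by
          intro k
          suffices f (i.succAbove k) ≠ 0 by
            obtain ⟨l, hl⟩ := Fin.exists_succ_eq.mpr this
            exact ⟨l, hl.symm⟩
          intro h
          exact Fin.succAbove_ne i k (hf (h.trans hi.symm))
        have h2 : ∀ k, ∃ l, g (j.succAbove k) = Fin.succ l := by
          intro k
          suffices g (j.succAbove k) ≠ 0 by
            obtain ⟨l, hl⟩ := Fin.exists_succ_eq.mpr this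
            exact ⟨l, hl.symm⟩
          intro h
          exact Fin.succAbove_ne j k (hg (h.trans hj.symm))
        choose f' hf' using h1
        choose g' hg' using h2
        have : (M.submatrix f g).submatrix i.succAbove j.succAbove =
            (M.submatrix Fin.succ Fin.succ).submatrix f' g' := by
          ext a b; simp [hf', hg']
        rw [this]
        exact det_mem_detIdeal _ _ _
      · have : (M.submatrix f g) i j = 0 := by
          obtain ⟨l, hl⟩ := Fin.exists_succ_eq.mpr hj
          simp [hi, ← hl, hr]
        rw [this]; simp
    · push Not at h0
      have h1 : ∀ k, ∃ l, f k = Fin.succ l := fun k => by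
        obtain ⟨l, hl⟩ := Fin.exists_succ_eq.mpr (h0 k)
        exact ⟨l, hl.symm⟩
      choose f' hf' using h1
      by_cases h0' : ∃ j, g j = 0
      · obtain ⟨j, hj⟩ := h0'
        rw [Matrix.det_eq_zero_of_column_eq_zero j]
        · exact Ideal.zero_mem _
        · intro i; simp [hf', hj, hc]
      · push Not at h0'
        have h1 : ∀ k, ∃ l, g k = Fin.succ l := fun k => by
          obtain ⟨l, hl⟩ := Fin.exists_succ_eq.mpr (h0' k)
          exact ⟨l, hl.symm⟩
        choose g' hg' using h1
        have : (M.submatrix f g) = (M.submatrix Fin.succ Fin.succ).submatrix f' g' := by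
          ext a b; simp [hf', hg']
        rw [this]
        exact detIdeal_succ_le _ (det_mem_detIdeal _ _ _)
  · rw [detIdeal_le_iff]
    intro f g
    have key : ((M.submatrix Fin.succ Fin.succ).submatrix f g).det =
        (M.submatrix (Fin.cons 0 (Fin.succ ∘ f) : Fin (t+1) → Fin (m+1))
          (Fin.cons 0 (Fin.succ ∘ g) : Fin (t+1) → Fin (n+1))).det := by
      rw [Matrix.det_succ_row_zero, Fin.sum_univ_succ]
      rw [Finset.sum_eq_zero]
      · simp [h00]
      · intro j _
        simp [hr]
    rw [key]
    exact det_mem_detIdeal _ _ _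

lemma exists_bordered {m : ℕ} (a : R) (r c : Fin m → R) :
    ∃ L : Matrix (Fin (m + 1)) (Fin (m + 1)) R, L 0 0 = a ∧ (∀ j : Fin m, L 0 j.succ = r j) ∧
      (∀ i : Fin m, L i.succ 0 = c i) ∧
      (∀ i j : Fin m, L i.succ j.succ = if i = j then 1 else 0) :=
  ⟨fun i j => Fin.cases (Fin.cases a r j)
      (fun i' => Fin.cases (c i') (fun j' => if i' = j' then 1 else 0) j) i,
    rfl, fun _ => rfl, fun _ => rfl, fun _ _ => rfl⟩

/-- Elimination with a unit entry at the corner. -/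
lemma exists_detIdeal_of_isUnit {m n t : ℕ} (M : Matrix (Fin (m + 1)) (Fin (n + 1)) R)
    (h00 : IsUnit (M 0 0)) :
    ∃ M' : Matrix (Fin m) (Fin n) R, detIdeal (t + 1) M = detIdeal t M' := by
  obtain ⟨u, hu⟩ := h00
  -- L = row elimination, W = column elimination
  obtain ⟨L, l1, l2, l3, l4⟩ := exists_bordered (↑u⁻¹ : R) (fun _ : Fin m => (0 : R))
    (fun i => - M i.succ 0 * ↑u⁻¹)
  obtain ⟨L', k1, k2, k3, k4⟩ := exists_bordered (↑u : R) (fun _ : Fin m => (0 : R))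
    (fun i => M i.succ 0)
  obtain ⟨W, w1, w2, w3, w4⟩ := exists_bordered (1 : R) (fun j : Fin n => - ↑u⁻¹ * M 0 j.succ)
    (fun _ => (0 : R))
  obtain ⟨W', v1, v2, v3, v4⟩ := exists_bordered (1 : R) (fun j : Fin n => ↑u⁻¹ * M 0 j.succ)
    (fun _ => (0 : R))
  have hL : L' * L = 1 := by
    ext i j
    induction i using Fin.cases <;> induction j using Fin.cases <;>
      simp [Matrix.mul_apply, Fin.sum_univ_succ, l1, l2, l3, l4, k1, k2, k3, k4, Matrix.one_apply,
        (Fin.succ_ne_zero _).symm]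
  have hW : W * W' = 1 := by
    ext i j
    induction i using Fin.cases <;> induction j using Fin.cases <;>
      simp [Matrix.mul_apply, Fin.sum_univ_succ, w1, w2, w3, w4, v1, v2, v3, v4, Matrix.one_apply,
        (Fin.succ_ne_zero _).symm]
  let N := L * M * W
  have hN : detIdeal (t+1) M = detIdeal (t+1) N := by
    apply le_antisymm
    · have : M = L' * (N * W') := by
        calc M = (L' * L) * M * (W * W') := by rw [hL, hW]; simp
          _ = _ := by simp only [N, Matrix.mul_assoc]
      conv_lhs => rw [this]
      exact (detIdeal_mul_left_le _ _).trans (detIdeal_mul_right_le _ _)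
    · exact (detIdeal_mul_right_le _ _).trans (detIdeal_mul_left_le _ _)
  refine ⟨N.submatrix Fin.succ Fin.succ, hN.trans (detIdeal_bordered N ?_ ?_ ?_)⟩
  · simp [N, Matrix.mul_apply, Fin.sum_univ_succ, l1, l2, l3, l4, w1, w2, w3, w4, ← hu]
  · intro j
    simp [N, Matrix.mul_apply, Fin.sum_univ_succ, l1, l2, l3, l4, w1, w2, w3, w4, ← hu]
  · intro j
    simp [N, Matrix.mul_apply, Fin.sum_univ_succ, l1, l2, l3, l4, w1, w2, w3, w4, ← hu]

lemma exists_detIdeal_of_isUnit' {m n t : ℕ} (M : Matrix (Fin (m + 1)) (Fin (n + 1)) R)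
    (i : Fin (m + 1)) (j : Fin (n + 1)) (h : IsUnit (M i j)) :
    ∃ M' : Matrix (Fin m) (Fin n) R, detIdeal (t + 1) M = detIdeal t M' := by
  obtain ⟨M', hM'⟩ := exists_detIdeal_of_isUnit (t := t)
    (M.submatrix (Equiv.swap 0 i) (Equiv.swap 0 j)) (by simpa using h)
  exact ⟨M', by rw [← hM', detIdeal_submatrix_equiv]⟩

end minors


section EagonNorthcott

/-- Minimality of `𝔪[X]` over the minors of the perturbed matrix. -/
lemma minimal_map_C {R : Type*} [CommRing R] [IsNoetherianRing R] [IsLocalRing R] {I : Ideal R}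
    (hI : IsLocalRing.maximalIdeal R ∈ I.minimalPrimes) (J : Ideal (Polynomial R))
    (hJ : J ≤ (IsLocalRing.maximalIdeal R).map Polynomial.C)
    (hIJ : I.map Polynomial.C ≤ J ⊔ Ideal.span {Polynomial.X}) :
    (IsLocalRing.maximalIdeal R).map Polynomial.C ∈ J.minimalPrimes := by
  set m := IsLocalRing.maximalIdeal R with hm
  set N : Ideal (Polynomial R) := m.comap Polynomial.constantCoeff with hN
  have hNp : N.IsPrime := Ideal.comap_isPrime _ _
  have hmN : m.map Polynomial.C ≤ N := by
    rw [Ideal.map_le_iff_le_comap]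
    intro x hx
    simpa [hN] using hx
  have hXN : (Polynomial.X : Polynomial R) ∈ N := by simp [hN]
  have hXm : (Polynomial.X : Polynomial R) ∉ m.map Polynomial.C := by
    rw [Ideal.mem_map_C_iff]
    intro h
    have := h 1
    rw [Polynomial.coeff_X_one] at this
    exact (Ideal.ne_top_iff_one m).mp (IsLocalRing.maximalIdeal.isMaximal R).ne_top this
  refine ⟨⟨inferInstance, hJ⟩, ?_⟩
  rintro Q ⟨hQ, hJQ⟩ hQm
  -- `N` is minimal over `Q + (X)`
  have hmin : N ∈ (Q ⊔ Ideal.span {Polynomial.X}).minimalPrimes := by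
    refine ⟨⟨hNp, sup_le (hQm.trans hmN) ?_⟩, ?_⟩
    · rw [Ideal.span_singleton_le_iff_mem]; exact hXN
    · rintro Q' ⟨hQ', hle⟩ hQN
      have h1 : I ≤ Q'.comap Polynomial.C := by
        rw [← Ideal.map_le_iff_le_comap]
        exact hIJ.trans ((sup_le_sup_right hJQ _).trans hle)
      have h2 : m ≤ Q'.comap Polynomial.C := by
        refine hI.2 ⟨Ideal.comap_isPrime _ _, h1⟩ ?_
        exact IsLocalRing.le_maximalIdeal (Ideal.comap_isPrime _ _).ne_top
      intro f hf
      rw [← Polynomial.divX_mul_X_add f]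
      refine Q'.add_mem (Q'.mul_mem_left _ ?_) (h2 hf)
      exact hle (Ideal.mem_sup_right (Ideal.mem_span_singleton_self _))
  have hht := Ideal.map_height_le_one_of_mem_minimalPrimes hmin
  by_contra hcon
  have hlt : Q < m.map Polynomial.C := lt_of_le_not_ge hQm hcon
  have hlt2 : m.map Polynomial.C < N := lt_of_le_of_ne hmN (fun h => hXm (h ▸ hXN))
  -- chain in the quotient
  let q := Ideal.Quotient.mk Q
  have key : ∀ P : Ideal (Polynomial R), Q ≤ P → (P.map q).comap q = P := fun P hP => by
    rw [Ideal.comap_map_of_surjective _ Ideal.Quotient.mk_surjective, sup_eq_left,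
      ← RingHom.ker_eq_comap_bot, Ideal.mk_ker]
    exact hP
  have kp : ∀ P : Ideal (Polynomial R), P.IsPrime → Q ≤ P → (P.map q).IsPrime := fun P hP h =>
    Ideal.map_isPrime_of_surjective Ideal.Quotient.mk_surjective (by rwa [Ideal.mk_ker])
  have klt : ∀ P P' : Ideal (Polynomial R), Q ≤ P → P < P' → P.map q < P'.map q :=
    fun P P' hP h => lt_of_le_of_ne (Ideal.map_mono h.le) (fun he => h.ne (by
      rw [← key P hP, ← key P' (hP.trans h.le), he]))
  have i1 := kp Q hQ le_rfl
  have i2 := kp (m.map Polynomial.C) inferInstance hQm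
  have i3 := kp N hNp (hQm.trans hmN)
  have c1 := Ideal.height_add_one_le_of_lt_of_isPrime (klt _ _ le_rfl hlt)
  have c2 := Ideal.height_add_one_le_of_lt_of_isPrime (klt _ _ hQm hlt2)
  have : (2 : ℕ∞) ≤ 1 := by
    calc (2 : ℕ∞) = 0 + 1 + 1 := by norm_num
      _ ≤ (Q.map q).height + 1 + 1 := by gcongr; exact zero_le
      _ ≤ _ := (add_le_add_left c1 1).trans (c2.trans hht)
  exact absurd this (by decide)

universe u

theorem eagonNorthcott_local (a b : ℕ) : ∀ (T : ℕ) (R : Type u) [CommRing R] [IsNoetherianRing R]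
    [IsLocalRing R] (M : Matrix (Fin (a + 1 + T)) (Fin (b + 1 + T)) R),
    IsLocalRing.maximalIdeal R ∈ (detIdeal (T + 1) M).minimalPrimes →
    (IsLocalRing.maximalIdeal R).height ≤ ((a + 1) * (b + 1) : ℕ) := by
  intro T
  induction T with
  | zero =>
    intro R _ _ _ M hM
    have h1 : detIdeal 1 M = Ideal.span (Set.range fun p : Fin (a+1) × Fin (b+1) => M p.1 p.2) := by
      apply le_antisymm
      · rw [detIdeal_le_iff]
        intro f g
        rw [Matrix.det_fin_one]
        exact Ideal.subset_span ⟨(f 0, g 0), rfl⟩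
      · rw [Ideal.span_le]
        rintro _ ⟨⟨i, j⟩, rfl⟩
        have := det_mem_detIdeal M (fun _ : Fin 1 => i) (fun _ => j)
        rw [Matrix.det_fin_one] at this
        exact this
    rw [zero_add, h1] at hM
    refine (Ideal.height_le_card_of_mem_minimalPrimes_span (Set.finite_range _) hM).trans ?_
    norm_cast
    rw [← Set.image_univ]
    refine (Set.ncard_image_le Set.finite_univ).trans ?_
    simp [Set.ncard_univ]
  | succ T ih =>
    have unitCase : ∀ (R : Type u) [CommRing R] [IsNoetherianRing R]
        [IsLocalRing R] (M : Matrix (Fin (a + 1 + T + 1)) (Fin (b + 1 + T + 1)) R),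
        IsLocalRing.maximalIdeal R ∈ (detIdeal (T + 1 + 1) M).minimalPrimes →
        ∀ i j, IsUnit (M i j) →
        (IsLocalRing.maximalIdeal R).height ≤ ((a + 1) * (b + 1) : ℕ) := by
      intro R _ _ _ M hM i j hij
      obtain ⟨M', hM'⟩ := exists_detIdeal_of_isUnit' (t := T + 1) M i j hij
      rw [hM'] at hM
      exact ih R M' hM
    intro R _ _ _ M hM
    change Matrix (Fin (a + 1 + T + 1)) (Fin (b + 1 + T + 1)) R at M
    by_cases hu : ∃ i j, IsUnit (M i j)
    · obtain ⟨i, j, hij⟩ := hu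
      exact unitCase R M hM i j hij
    push Not at hu
    have hmem : ∀ i j, M i j ∈ IsLocalRing.maximalIdeal R := fun i j =>
      (IsLocalRing.mem_maximalIdeal _).mpr (hu i j)
    let M' : Matrix (Fin (a + 1 + T + 1)) (Fin (b + 1 + T + 1)) (Polynomial R) :=
      fun i j => Polynomial.C (M i j) + (if i = 0 ∧ j = 0 then Polynomial.X else 0)
    have hM' : ∀ i j, M' i j =
      Polynomial.C (M i j) + (if i = 0 ∧ j = 0 then Polynomial.X else 0) := fun _ _ => rfl
    let p := (IsLocalRing.maximalIdeal R).map (Polynomial.C (R := R))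
    have hp : p.IsPrime := inferInstance
    have hmin : p ∈ (detIdeal (T + 1 + 1) M').minimalPrimes := by
      refine minimal_map_C hM _ ?_ ?_
      · rw [detIdeal_le_iff]
        intro f g
        by_cases hf : Function.Injective f
        swap
        · rw [Function.not_injective_iff] at hf
          obtain ⟨a, b, hab, hne⟩ := hf
          rw [Matrix.det_zero_of_row_eq hne]
          · exact Ideal.zero_mem _
          · ext j; simp [hab]
        -- some row is not the zeroth row
        obtain ⟨i, hi⟩ : ∃ i, f i ≠ 0 := by
          by_contra hcon
          push Not at hcon
          have : (0 : Fin (T + 1 + 1)) = 1 := hf ((hcon 0).trans (hcon 1).symm)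
          simp at this
        rw [Matrix.det_succ_row _ i]
        refine Ideal.sum_mem _ fun j _ => ?_
        refine Ideal.mul_mem_right _ _ (Ideal.mul_mem_left _ _ ?_)
        have : (M'.submatrix f g) i j = Polynomial.C (M (f i) (g j)) := by
          rw [Matrix.submatrix_apply, hM', if_neg (fun h => hi h.1), add_zero]
        rw [this]
        exact Ideal.mem_map_of_mem _ (hmem _ _)
      · rw [← detIdeal_map, detIdeal_le_iff]
        intro f g
        let q := Ideal.Quotient.mk (Ideal.span {(Polynomial.X : Polynomial R)})
        have h1 : q (((M.map Polynomial.C).submatrix f g).det - (M'.submatrix f g).det) = 0 := by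
          rw [map_sub, RingHom.map_det, RingHom.map_det, sub_eq_zero]
          congr 1
          ext i j
          have : q Polynomial.X = 0 := Ideal.Quotient.eq_zero_iff_mem.mpr
            (Ideal.mem_span_singleton_self _)
          simp only [RingHom.mapMatrix_apply, Matrix.map_apply, Matrix.submatrix_apply, hM',
            map_add]
          split_ifs <;> simp [this]
        rw [Ideal.Quotient.eq_zero_iff_mem] at h1
        rw [← sub_add_cancel ((M.map Polynomial.C).submatrix f g).det (M'.submatrix f g).det]
        exact Ideal.add_mem _ (Ideal.mem_sup_right h1)
          (Ideal.mem_sup_left (det_mem_detIdeal _ _ _))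
    -- localise
    let S := Localization.AtPrime p
    have hS : IsLocalRing.maximalIdeal S ∈
        (detIdeal (T + 1 + 1) (M'.map (algebraMap (Polynomial R) S))).minimalPrimes := by
      rw [detIdeal_map, IsLocalization.minimalPrimes_map p.primeCompl S, Set.mem_preimage,
        Localization.AtPrime.under_maximalIdeal]
      exact hmin
    have hunit : IsUnit ((M'.map (algebraMap (Polynomial R) S)) 0 0) := by
      rw [Matrix.map_apply]
      refine IsLocalization.map_units S (⟨M' 0 0, ?_⟩ : p.primeCompl)
      intro h
      have h' : M' 0 0 ∈ p := h
      simp only [p] at h'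
      rw [Ideal.mem_map_C_iff] at h'
      have := h' 1
      simp [hM', Polynomial.coeff_C] at this
    have := unitCase S _ hS 0 0 hunit
    rw [← Polynomial.height_map_C (IsLocalRing.maximalIdeal R)]
    rw [← IsLocalization.height_under p.primeCompl, Localization.AtPrime.under_maximalIdeal] at this
    exact this

theorem eagonNorthcott {R : Type u} [CommRing R] [IsNoetherianRing R] {m n t : ℕ} (ht : 1 ≤ t)
    (htn : t ≤ n) (htm : t ≤ m) (M : Matrix (Fin m) (Fin n) R) (p : Ideal R)
    (hp : p ∈ (detIdeal t M).minimalPrimes) :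
    p.height ≤ ((m - t + 1) * (n - t + 1) : ℕ) := by
  obtain ⟨T, rfl⟩ := Nat.exists_eq_add_of_le' ht
  obtain ⟨a, rfl⟩ : ∃ a, m = a + 1 + T := ⟨m - (T + 1), by omega⟩
  obtain ⟨b, rfl⟩ : ∃ b, n = b + 1 + T := ⟨n - (T + 1), by omega⟩
  have : p.IsPrime := hp.1.1
  let S := Localization.AtPrime p
  have hS : IsLocalRing.maximalIdeal S ∈
      (detIdeal (T + 1) (M.map (algebraMap R S))).minimalPrimes := by
    rw [detIdeal_map, IsLocalization.minimalPrimes_map p.primeCompl S, Set.mem_preimage,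
      Localization.AtPrime.under_maximalIdeal]
    exact hp
  have := eagonNorthcott_local a b T S _ hS
  rw [← IsLocalization.height_under p.primeCompl, Localization.AtPrime.under_maximalIdeal] at this
  have e1 : a + 1 + T - (T + 1) = a := by omega
  have e2 : b + 1 + T - (T + 1) = b := by omega
  rw [e1, e2]
  exact this

end EagonNorthcott

section PSHeight

/-- The ideal `q⟦X⟧` of power series with all coefficients in `q`. -/
def psExt {A : Type*} [CommRing A] (q : Ideal A) : Ideal (PowerSeries A) :=
  RingHom.ker (PowerSeries.map (Ideal.Quotient.mk q))

lemma mem_psExt {A : Type*} [CommRing A] (q : Ideal A) (f : PowerSeries A) :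
    f ∈ psExt q ↔ ∀ n, PowerSeries.coeff n f ∈ q := by
  rw [psExt, RingHom.mem_ker, PowerSeries.ext_iff]
  refine forall_congr' fun n => ?_
  rw [PowerSeries.coeff_map, map_zero, Ideal.Quotient.eq_zero_iff_mem]

instance psExt_isPrime {A : Type*} [CommRing A] (q : Ideal A) [q.IsPrime] :
    (psExt q).IsPrime := RingHom.ker_isPrime _

lemma comap_C_psExt {A : Type*} [CommRing A] (q : Ideal A) :
    (psExt q).comap (PowerSeries.C (R := A)) = q := by
  ext x
  rw [Ideal.mem_comap, mem_psExt]
  constructor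
  · intro h; simpa using h 0
  · intro h n
    rw [PowerSeries.coeff_C]
    split_ifs
    · exact h
    · exact q.zero_mem

lemma height_le_height_psExt {A : Type*} [CommRing A] (q : Ideal A) [hq : q.IsPrime] :
    q.height ≤ (psExt q).height := by
  let F : PrimeSpectrum A → PrimeSpectrum (PowerSeries A) := fun p =>
    ⟨psExt p.asIdeal, inferInstance⟩
  have hF : StrictMono F := by
    intro p p' h
    refine lt_of_le_of_ne ?_ ?_
    · intro f hf
      change f ∈ psExt p.asIdeal at hf
      change f ∈ psExt p'.asIdeal
      rw [mem_psExt] at hf ⊢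
      exact fun n => h.le (hf n)
    · intro he
      have h2 : psExt p.asIdeal = psExt p'.asIdeal := congrArg PrimeSpectrum.asIdeal he
      have h3 := congrArg (Ideal.comap (PowerSeries.C (R := A))) h2
      rw [comap_C_psExt, comap_C_psExt] at h3
      exact h.ne (PrimeSpectrum.ext h3)
  have := Order.height_le_height_apply_of_strictMono F hF ⟨q, hq⟩
  rw [← PrimeSpectrum.height_eq_orderHeight, ← PrimeSpectrum.height_eq_orderHeight] at this
  exact this

lemma psExt_comap_le {A : Type*} [CommRing A] [IsNoetherianRing A] (P : Ideal (PowerSeries A)) :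
    psExt (P.comap (PowerSeries.C (R := A))) ≤ P := by
  intro f hf
  rw [mem_psExt] at hf
  obtain ⟨N, g, hg⟩ := Submodule.fg_iff_exists_fin_generating_family.mp
    ((isNoetherianRing_iff_ideal_fg A).mp inferInstance (P.comap (PowerSeries.C (R := A))))
  have h1 : ∀ n, ∃ c : Fin N → A, ∑ i, c i • g i = PowerSeries.coeff n f := fun n => by
    rw [← Submodule.mem_span_range_iff_exists_fun, hg]
    exact hf n
  choose c hc using h1
  have h2 : f = ∑ i, PowerSeries.mk (fun n => c n i) * PowerSeries.C (g i) := by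
    ext n
    rw [map_sum, ← hc n]
    refine Finset.sum_congr rfl fun i _ => ?_
    rw [PowerSeries.coeff_mul_C, PowerSeries.coeff_mk, smul_eq_mul]
  rw [h2]
  refine Ideal.sum_mem _ fun i _ => Ideal.mul_mem_left _ _ ?_
  have : g i ∈ P.comap (PowerSeries.C (R := A)) := by
    rw [← hg]; exact Submodule.subset_span ⟨i, rfl⟩
  exact this

/-- Lemma on jumps of heights in power series rings, when no prime `q⟦X⟧` fits. -/
lemma height_comap_C_add_one_le {A : Type*} [CommRing A] [IsNoetherianRing A]
    (P : Ideal (PowerSeries A)) [P.IsPrime]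
    (f : PowerSeries A) (hf : f ∈ P)
    (n : ℕ) (hn : PowerSeries.coeff n f ∉ P.comap (PowerSeries.C (R := A))) :
    (P.comap (PowerSeries.C (R := A))).height + 1 ≤ P.height := by
  have hp : (P.comap (PowerSeries.C (R := A))).IsPrime := Ideal.comap_isPrime _ _
  have hlt : psExt (P.comap (PowerSeries.C (R := A))) < P := by
    refine lt_of_le_of_ne (psExt_comap_le P) fun h => hn ?_
    rw [← h, mem_psExt] at hf
    exact hf n
  exact (add_le_add_left (height_le_height_psExt _) 1).trans
    (Ideal.height_add_one_le_of_lt_of_isPrime hlt)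

open MvPowerSeries in
/-- The map `K[ℕ] → K⟦x_0,…,x_{s-1}⟧` sending `X_k` to `x_{h+k}` (or `0`). -/
def thetaHom (K : Type*) [Field K] (s h : ℕ) :
    MvPolynomial ℕ K →+* MvPowerSeries (Fin s) K :=
  MvPolynomial.eval₂Hom (MvPowerSeries.C (σ := Fin s) (R := K))
    (fun k => if hk : h + k < s then MvPowerSeries.X ⟨h + k, hk⟩ else 0)

/-- The inclusion of power series in fewer variables. -/
def iotaHom (K : Type*) [Field K] (s : ℕ) :
    MvPowerSeries (Fin s) K →+* MvPowerSeries (Fin (s + 1)) K :=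
  ((MvPowerSeries.finSuccEquiv K s).symm : _ →+* _).comp
    (PowerSeries.C (R := MvPowerSeries (Fin s) K))

lemma finSuccEquiv_iotaHom (K : Type*) [Field K] (s : ℕ) (f : MvPowerSeries (Fin s) K) :
    MvPowerSeries.finSuccEquiv K s (iotaHom K s f) = PowerSeries.C f := by
  simp [iotaHom]

lemma iotaHom_X (K : Type*) [Field K] (s : ℕ) (j : Fin s) :
    iotaHom K s (MvPowerSeries.X j) = MvPowerSeries.X j.succ := by
  apply (MvPowerSeries.finSuccEquiv K s).injective
  rw [finSuccEquiv_iotaHom, MvPowerSeries.finSuccEquiv_X_succ]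

lemma iotaHom_C (K : Type*) [Field K] (s : ℕ) (c : K) :
    iotaHom K s (MvPowerSeries.C c) = MvPowerSeries.C c := by
  apply (MvPowerSeries.finSuccEquiv K s).injective
  rw [finSuccEquiv_iotaHom, MvPowerSeries.finSuccEquiv_C]

lemma iotaHom_comp_thetaHom (K : Type*) [Field K] (s h : ℕ) :
    (iotaHom K s).comp (thetaHom K s h) = thetaHom K (s + 1) (h + 1) := by
  apply MvPolynomial.ringHom_ext
  · intro c; simp [thetaHom, iotaHom_C]
  · intro k
    simp only [thetaHom, RingHom.comp_apply, MvPolynomial.coe_eval₂Hom, MvPolynomial.eval₂_X]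
    by_cases hk : h + k < s
    · rw [dif_pos hk, dif_pos (by omega), iotaHom_X]
      congr 1
      ext; simp; omega
    · rw [dif_neg hk, dif_neg (by omega), map_zero]

/-- If `x_j` (for `j < h`) is integral modulo `P` over the subring generated by the `x_k`, `k ≥ h`,
then `P` has height at least `h`. -/
lemma le_height_of_integral (K : Type*) [Field K] (h : ℕ) : ∀ (s : ℕ) (_ : h ≤ s)
    (P : Ideal (MvPowerSeries (Fin s) K)) [P.IsPrime]
    (_ : ∀ j : Fin s, (j : ℕ) < h → ∃ q : Polynomial (MvPolynomial ℕ K), q.Monic ∧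
      q.eval₂ (thetaHom K s h) (MvPowerSeries.X j) ∈ P), (h : ℕ∞) ≤ P.height := by
  induction h with
  | zero => intro s _ P _ _; simp
  | succ h ih =>
    intro s hs P hP hq
    obtain ⟨s, rfl⟩ : ∃ s', s = s' + 1 := ⟨s - 1, by omega⟩
    have hP0 : (P.comap (iotaHom K s)).IsPrime := Ideal.comap_isPrime _ _
    have h0 := ih s (by omega) (P.comap (iotaHom K s)) (fun j hj => by
      obtain ⟨q, hq1, hq2⟩ := hq j.succ (by simpa using hj)
      refine ⟨q, hq1, ?_⟩
      rw [Ideal.mem_comap, Polynomial.hom_eval₂, iotaHom_comp_thetaHom, iotaHom_X]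
      exact hq2)
    let e : MvPowerSeries (Fin (s + 1)) K ≃+* PowerSeries (MvPowerSeries (Fin s) K) :=
      (MvPowerSeries.finSuccEquiv K s).toRingEquiv
    let Q : Ideal (PowerSeries (MvPowerSeries (Fin s) K)) := P.comap e.symm
    have hQ : Q.IsPrime := Ideal.comap_isPrime _ _
    have hQP : Q.height = P.height := RingEquiv.height_comap e.symm P
    have hQ0 : Q.comap (PowerSeries.C (R := MvPowerSeries (Fin s) K)) = P.comap (iotaHom K s) :=
      rfl
    obtain ⟨q, hq1, hq2⟩ := hq 0 (by simp)
    have hm : e (q.eval₂ (thetaHom K (s + 1) (h + 1)) (MvPowerSeries.X 0)) =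
        ((q.map (thetaHom K s h) : Polynomial _) : PowerSeries (MvPowerSeries (Fin s) K)) := by
      have e1 : ((e : _ →+* PowerSeries (MvPowerSeries (Fin s) K)).comp
          (thetaHom K (s + 1) (h + 1))) =
          (PowerSeries.C (R := MvPowerSeries (Fin s) K)).comp (thetaHom K s h) := by
        rw [← iotaHom_comp_thetaHom, ← RingHom.comp_assoc]
        congr 1
        ext1 f
        exact finSuccEquiv_iotaHom K s f
      have e2 : e (MvPowerSeries.X 0) = PowerSeries.X := MvPowerSeries.finSuccEquiv_X_zero ..
      change (e : MvPowerSeries (Fin (s + 1)) K →+* PowerSeries (MvPowerSeries (Fin s) K)) _ = _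
      rw [Polynomial.hom_eval₂, e1, RingHom.coe_coe, e2]
      rw [← Polynomial.eval₂_C_X_eq_coe, Polynomial.eval₂_map]
    have hmem : ((q.map (thetaHom K s h) : Polynomial _) :
        PowerSeries (MvPowerSeries (Fin s) K)) ∈ Q := by
      rw [← hm]
      change e.symm (e _) ∈ P
      rw [RingEquiv.symm_apply_apply]
      exact hq2
    have := height_comap_C_add_one_le Q _ hmem (q.natDegree) (by
      rw [Polynomial.coeff_coe, Polynomial.coeff_map, hq1.coeff_natDegree, map_one]
      exact fun h1 => (Ideal.comap_isPrime _ _).ne_top ((Ideal.eq_top_iff_one _).mpr h1))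
    rw [hQ0, hQP] at this
    push_cast
    exact (add_le_add_left h0 1).trans this

end PSHeight

section Truncation

variable {K : Type*} [Field K]

lemma exists_decomp (s : ℕ) : ∀ f : MvPowerSeries (Fin s) K,
    ∃ (c : K) (g : Fin s → MvPowerSeries (Fin s) K),
      f = MvPowerSeries.C c + ∑ i, MvPowerSeries.X i * g i := by
  induction s with
  | zero =>
    intro f
    refine ⟨MvPowerSeries.constantCoeff f, fun i => 0, ?_⟩
    ext n
    have : n = 0 := Subsingleton.elim _ _
    subst this
    simp
  | succ s ih =>
    intro f
    let e := MvPowerSeries.finSuccEquiv K s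
    obtain ⟨c, g, hg⟩ := ih (PowerSeries.constantCoeff (e f))
    let G := e.symm (PowerSeries.mk fun p => PowerSeries.coeff (p + 1) (e f))
    refine ⟨c, Fin.cons G (fun i => iotaHom K s (g i)), ?_⟩
    apply e.injective
    rw [Fin.sum_univ_succ]
    simp only [Fin.cons_zero, Fin.cons_succ, map_add, map_mul, map_sum]
    have h1 : e (MvPowerSeries.X 0) = PowerSeries.X := MvPowerSeries.finSuccEquiv_X_zero ..
    have h2 : ∀ j : Fin s, e (MvPowerSeries.X j.succ) = PowerSeries.C (MvPowerSeries.X j) :=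
      fun j => MvPowerSeries.finSuccEquiv_X_succ ..
    have h3 : e (MvPowerSeries.C c) = PowerSeries.C (MvPowerSeries.C c) :=
      MvPowerSeries.finSuccEquiv_C ..
    have h4 : ∀ i, e (iotaHom K s (g i)) = PowerSeries.C (g i) :=
      fun i => finSuccEquiv_iotaHom K s (g i)
    have h5 : e G = PowerSeries.mk fun p => PowerSeries.coeff (p + 1) (e f) :=
      AlgEquiv.apply_symm_apply _ _
    simp only [h1, h2, h3, h4, h5]
    conv_lhs => rw [PowerSeries.eq_X_mul_shift_add_const (e f), hg]
    simp only [map_add, map_mul, map_sum]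
    ring

lemma X_mem_mIdeal {s : ℕ} (i : Fin s) : (MvPowerSeries.X i : MvPowerSeries (Fin s) K) ∈ mIdeal s K :=
  Ideal.subset_span ⟨i, rfl⟩

lemma sum_X_mul_mem_mIdeal {s : ℕ} (g : Fin s → MvPowerSeries (Fin s) K) :
    ∑ i, MvPowerSeries.X i * g i ∈ mIdeal s K :=
  Ideal.sum_mem _ fun i _ => Ideal.mul_mem_right _ _ (X_mem_mIdeal i)

lemma mIdeal_eq_ker (s : ℕ) :
    mIdeal s K = RingHom.ker (MvPowerSeries.constantCoeff (σ := Fin s) (R := K)) := by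
  apply le_antisymm
  · rw [mIdeal, Ideal.span_le]
    rintro _ ⟨i, rfl⟩
    simp
  · intro f hf
    obtain ⟨c, g, rfl⟩ := exists_decomp s f
    rw [RingHom.mem_ker] at hf
    have hc : c = 0 := by simpa using hf
    rw [hc, map_zero, zero_add]
    exact sum_X_mul_mem_mIdeal g

instance mIdeal_isPrime (s : ℕ) : (mIdeal s K).IsPrime := by
  rw [mIdeal_eq_ker]; exact RingHom.ker_isPrime _

/-- Polynomials of degree at most `k`. -/
inductive IsPolyLe {s : ℕ} : ℕ → MvPowerSeries (Fin s) K → Prop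
  | const (k : ℕ) (c : K) : IsPolyLe k (MvPowerSeries.C c)
  | step (k : ℕ) (c : K) (g : Fin s → MvPowerSeries (Fin s) K) (hg : ∀ i, IsPolyLe k (g i)) :
      IsPolyLe (k + 1) (MvPowerSeries.C c + ∑ i, MvPowerSeries.X i * g i)

lemma exists_trunc {s : ℕ} (k : ℕ) : ∀ f : MvPowerSeries (Fin s) K,
    ∃ g, IsPolyLe k g ∧ g - f ∈ mIdeal s K ^ (k + 1) := by
  induction k with
  | zero =>
    intro f
    obtain ⟨c, g, rfl⟩ := exists_decomp s f
    refine ⟨MvPowerSeries.C c, .const 0 c, ?_⟩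
    rw [sub_add_cancel_left, zero_add, pow_one]
    exact neg_mem (sum_X_mul_mem_mIdeal g)
  | succ k ih =>
    intro f
    obtain ⟨c, g, rfl⟩ := exists_decomp s f
    choose g' h1 h2 using fun i => ih (g i)
    refine ⟨_, .step k c g' h1, ?_⟩
    rw [add_sub_add_left_eq_sub, ← Finset.sum_sub_distrib]
    refine Ideal.sum_mem _ fun i _ => ?_
    rw [← mul_sub, pow_succ']
    exact Ideal.mul_mem_mul (X_mem_mIdeal i) (h2 i)

lemma IsPolyLe.valuation_le {s k : ℕ} {g : MvPowerSeries (Fin s) K} (hg : IsPolyLe k g)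
    {L Γ : Type*} [Field L] [LinearOrderedCommGroupWithZero Γ] (v : Valuation L Γ)
    (ψ : MvPowerSeries (Fin s) K →+* L) (hC : ∀ c, v (ψ (MvPowerSeries.C c)) ≤ 1)
    (w : Γ) (hw : 1 ≤ w) (hX : ∀ i, v (ψ (MvPowerSeries.X i)) ≤ w) : v (ψ g) ≤ w ^ k := by
  induction hg with
  | const k c => exact (hC c).trans (one_le_pow₀ hw)
  | step k c g hg ih =>
    rw [map_add, map_sum]
    refine v.map_add_le ((hC c).trans (one_le_pow₀ hw)) (v.map_sum_le fun i _ => ?_)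
    rw [map_mul, map_mul, pow_succ']
    exact mul_le_mul' (hX i) (ih i)

end Truncation

section Cmat

/-- Entries of the generic matrix with Vandermonde weights on the diagonals. -/
def cfun {F : Type*} [CommRing F] (p q : ℕ) (α : ℕ → F) (y : ℕ → ℕ → F) (i j : ℕ) : F :=
  ∑ a ∈ Finset.range p, ∑ b ∈ Finset.range q,
    if a + j = b + i then y a b * α i ^ (min a b) else 0

lemma map_cfun {F F' : Type*} [CommRing F] [CommRing F'] (φ : F →+* F') (p q : ℕ) (α : ℕ → F)
    (y : ℕ → ℕ → F) (i j : ℕ) :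
    φ (cfun p q α y i j) = cfun p q (fun i => φ (α i)) (fun a b => φ (y a b)) i j := by
  simp only [cfun, map_sum, apply_ite φ, map_mul, map_pow, map_zero]

lemma mul_cfun {F : Type*} [CommRing F] (c : F) (p q : ℕ) (α : ℕ → F)
    (y : ℕ → ℕ → F) (i j : ℕ) :
    c * cfun p q α y i j = cfun p q α (fun a b => c * y a b) i j := by
  simp only [cfun, Finset.mul_sum, mul_ite, mul_zero, mul_assoc]

lemma cfun_mem {F : Type*} [CommRing F] (I : Ideal F) (p q : ℕ) (α : ℕ → F)
    (y : ℕ → ℕ → F) (hy : ∀ a b, y a b ∈ I) (i j : ℕ) : cfun p q α y i j ∈ I := by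
  refine Ideal.sum_mem _ fun a _ => Ideal.sum_mem _ fun b _ => ?_
  split_ifs
  · exact Ideal.mul_mem_right _ _ (hy a b)
  · exact I.zero_mem

lemma exists_minor_ne_zero {F : Type*} [Field F] {m n p q t : ℕ} (hm : p + t = m + 1)
    (hn : q + t = n + 1) (α : ℕ → F) (hα : Function.Injective α)
    (y : ℕ → ℕ → F) (a₁ b₁ : ℕ) (ha₁ : a₁ < p) (hb₁ : b₁ < q) (hy₁ : y a₁ b₁ ≠ 0) :
    ∃ (f : Fin t → Fin m) (g : Fin t → Fin n),
      (Matrix.of fun i j => cfun p q α y (f i) (g j)).det ≠ 0 := by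
  classical
  obtain ⟨⟨a₀, b₀⟩, h0, hmin⟩ := Finset.exists_min_image
    ((Finset.range p ×ˢ Finset.range q).filter fun x => y x.1 x.2 ≠ 0)
    (fun x => (x.1 : ℤ) - x.2) ⟨(a₁, b₁), by simp [ha₁, hb₁, hy₁]⟩
  simp only [Finset.mem_filter, Finset.mem_product, Finset.mem_range] at h0 hmin
  obtain ⟨⟨ha₀, hb₀⟩, hy₀⟩ := h0
  have hzero : ∀ a b, a < p → b < q → (a : ℤ) - b < a₀ - b₀ → y a b = 0 := by
    intro a b ha hb hab
    by_contra hne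
    have := hmin (a, b) ⟨⟨ha, hb⟩, hne⟩
    simp only at this
    omega
  obtain ⟨u, hu⟩ : ∃ u, u = a₀ - b₀ := ⟨_, rfl⟩
  obtain ⟨w, hw⟩ : ∃ w, w = b₀ - a₀ := ⟨_, rfl⟩
  let Q : Polynomial F := ∑ a ∈ Finset.range p, ∑ b ∈ Finset.range q,
    if a + w = b + u then Polynomial.C (y a b) * Polynomial.X ^ (min a b) else 0
  have hQeval : ∀ e, cfun p q α y (e + u) (e + w) = Q.eval (α (e + u)) := by
    intro e
    simp only [Q, cfun, Polynomial.eval_finset_sum]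
    refine Finset.sum_congr rfl fun a _ => Finset.sum_congr rfl fun b _ => ?_
    by_cases h : a + w = b + u
    · rw [if_pos (by omega), if_pos h]; simp
    · rw [if_neg (by omega), if_neg h]; simp
  have hQ0 : Q ≠ 0 := by
    intro h
    have h1 := congrArg (fun P => Polynomial.coeff P (min a₀ b₀)) h
    simp only [Q, Polynomial.finset_sum_coeff, Polynomial.coeff_zero] at h1
    rw [Finset.sum_eq_single a₀, Finset.sum_eq_single b₀, if_pos (by omega)] at h1
    · simp at h1
      exact hy₀ h1
    · intro b _ hb
      rw [if_neg (by omega)]; simp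
    · intro h; simp [hb₀] at h
    · intro a _ ha
      refine Finset.sum_eq_zero fun b _ => ?_
      split_ifs with hab
      · rw [Polynomial.coeff_C_mul, Polynomial.coeff_X_pow, if_neg (by omega), mul_zero]
      · simp
    · intro h; simp [ha₀] at h
  obtain ⟨r, hr⟩ : ∃ r, r = min (p - u) (q - w) := ⟨_, rfl⟩
  have hQdeg : Q.natDegree ≤ r - 1 := by
    refine Polynomial.natDegree_sum_le_of_forall_le _ _ fun a ha =>
      Polynomial.natDegree_sum_le_of_forall_le _ _ fun b hb => ?_
    rw [Finset.mem_range] at ha hb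
    split_ifs with hab
    · refine (Polynomial.natDegree_C_mul_X_pow_le _ _).trans ?_
      omega
    · simp
  let Z := (Finset.range (r + t - 1)).filter fun e => Q.eval (α (e + u)) = 0
  let S := (Finset.range (r + t - 1)).filter fun e => ¬ Q.eval (α (e + u)) = 0
  have hZ : Z.card ≤ r - 1 := by
    have h1 : (Z.image fun e => α (e + u)).card = Z.card :=
      Finset.card_image_of_injective _ (fun a b hab => by have := hα hab; omega)
    rw [← h1]
    refine le_trans ?_ ((Polynomial.card_roots' Q).trans hQdeg)
    refine le_trans (Finset.card_le_card ?_) (Multiset.toFinset_card_le Q.roots)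
    intro x hx
    obtain ⟨e, he, rfl⟩ := Finset.mem_image.mp hx
    rw [Multiset.mem_toFinset, Polynomial.mem_roots hQ0]
    exact (Finset.mem_filter.mp he).2
  have hZS : Z.card + S.card = r + t - 1 := by
    rw [Finset.card_filter_add_card_filter_not, Finset.card_range]
  have hS : t ≤ S.card := by omega
  obtain ⟨S', hS', hcard⟩ := Finset.exists_subset_card_eq hS
  let E := S'.orderEmbOfFin hcard
  have hE : ∀ i, E i < r + t - 1 ∧ Q.eval (α (E i + u)) ≠ 0 := fun i => by
    have := hS' (S'.orderEmbOfFin_mem hcard i)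
    simpa [S] using this
  refine ⟨fun i => ⟨E i + u, ?_⟩, fun i => ⟨E i + w, ?_⟩, ?_⟩
  · have := (hE i).1; omega
  · have := (hE i).1; omega
  rw [Matrix.det_of_lowerTriangular]
  · rw [Finset.prod_ne_zero_iff]
    intro i _
    simp only [Matrix.of_apply]
    rw [hQeval]
    exact (hE i).2
  · intro i j hij
    have hij' : i < j := hij
    have hlt : E i < E j := E.strictMono hij'
    simp only [Matrix.of_apply, cfun]
    refine Finset.sum_eq_zero fun a ha => Finset.sum_eq_zero fun b hb => ?_
    rw [Finset.mem_range] at ha hb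
    split_ifs with hab
    · rw [hzero a b ha hb (by omega), zero_mul]
    · rfl

end Cmat

section LowerBound

variable {K : Type*} [Field K]

/-- The perturbation coefficients. -/
def yCoef (K : Type*) [Field K] {s h : ℕ} (hs : h ≤ s) (q k : ℕ) (a b : ℕ) :
    MvPowerSeries (Fin s) K :=
  if hh : a * q + b < h then MvPowerSeries.X ⟨a * q + b, lt_of_lt_of_le hh hs⟩ ^ (k + 1) else 0

lemma yCoef_mem {s h : ℕ} (hs : h ≤ s) (q k : ℕ) (a b : ℕ) :
    yCoef K hs q k a b ∈ mIdeal s K ^ (k + 1) := by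
  unfold yCoef
  split_ifs
  · exact Ideal.pow_mem_pow (X_mem_mIdeal _) _
  · exact Ideal.zero_mem _

/-- The perturbed matrix. -/
def bMat {s h m n : ℕ} (hs : h ≤ s) (p q k : ℕ) (α : ℕ → K)
    (A₀ : Matrix (Fin m) (Fin n) (MvPowerSeries (Fin s) K)) :
    Matrix (Fin m) (Fin n) (MvPowerSeries (Fin s) K) :=
  fun i j => A₀ i j + cfun p q (fun i => MvPowerSeries.C (α i)) (yCoef K hs q k) i j

lemma mem_valuationSubring {L : Type*} [Field L] (V : ValuationSubring L)
    {s h m n p q k t : ℕ} (hs : h ≤ s) (hpq : h ≤ p * q) (hm : p + t = m + 1)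
    (hn : q + t = n + 1) (α : ℕ → K) (hα : Function.Injective α)
    (A₀ : Matrix (Fin m) (Fin n) (MvPowerSeries (Fin s) K)) (hA₀ : ∀ i j, IsPolyLe k (A₀ i j))
    (ψ : MvPowerSeries (Fin s) K →+* L) (hC : ∀ c, ψ (MvPowerSeries.C c) ∈ V)
    (hX : ∀ j : Fin s, h ≤ j → ψ (MvPowerSeries.X j) ∈ V)
    (hB : ∀ f g, ψ (((bMat hs p q k α A₀).submatrix f g : Matrix (Fin t) (Fin t) _).det) = 0)
    (j : Fin s) : ψ (MvPowerSeries.X j) ∈ V := by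
  by_contra hj
  let v := V.valuation
  obtain ⟨j₀, -, hmax⟩ := Finset.exists_max_image (Finset.univ : Finset (Fin s))
    (fun j => v (ψ (MvPowerSeries.X j))) ⟨j, Finset.mem_univ _⟩
  set x₀ := ψ (MvPowerSeries.X j₀) with hx₀
  have hw : 1 < v x₀ := by
    refine lt_of_lt_of_le ?_ (hmax j (Finset.mem_univ _))
    rw [← not_le, V.valuation_le_one_iff]
    exact hj
  have hj₀ : (j₀ : ℕ) < h := by
    by_contra hcon
    have := (V.valuation_le_one_iff _).mpr (hX j₀ (not_lt.mp hcon))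
    exact absurd this (not_le.mpr hw)
  have hx0 : x₀ ≠ 0 := by
    intro h0
    rw [h0, map_zero] at hw
    exact absurd hw (not_lt.mpr zero_le)
  have hwpos : 0 < v x₀ := lt_trans zero_lt_one hw
  set c := (x₀ ^ (k + 1))⁻¹ with hc
  have hvc : v c = (v x₀ ^ (k + 1))⁻¹ := by rw [hc, map_inv₀, map_pow]
  have hpos : 0 < v x₀ ^ (k + 1) := pow_pos hwpos _
  -- the truncated part lies in the maximal ideal
  have hA1 : ∀ i j, v (c * ψ (A₀ i j)) < 1 := by
    intro i j
    have h1 := (hA₀ i j).valuation_le v ψ (fun c => (V.valuation_le_one_iff _).mpr (hC c))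
      (v x₀) hw.le (fun i => hmax i (Finset.mem_univ _))
    rw [map_mul, hvc, mul_comm, ← div_eq_mul_inv, div_lt_one₀ hpos]
    exact lt_of_le_of_lt h1 (pow_lt_pow_right₀ hw (Nat.lt_succ_self k))
  have hY1 : ∀ a b, c * ψ (yCoef K hs q k a b) ∈ V := by
    intro a b
    rw [← V.valuation_le_one_iff, map_mul]
    change v c * _ ≤ 1
    rw [hvc, mul_comm, ← div_eq_mul_inv, div_le_one₀ hpos]
    unfold yCoef
    split_ifs with hh
    · rw [map_pow, map_pow]
      exact pow_le_pow_left' (hmax _ (Finset.mem_univ _)) _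
    · rw [map_zero, map_zero]; exact zero_le
  let A' : Fin m → Fin n → V := fun i j =>
    ⟨c * ψ (A₀ i j), (V.valuation_le_one_iff _).mp (hA1 i j).le⟩
  let y' : ℕ → ℕ → V := fun a b => ⟨c * ψ (yCoef K hs q k a b), hY1 a b⟩
  let κ : K →+* V := (ψ.comp (MvPowerSeries.C (σ := Fin s) (R := K))).codRestrict V.toSubring hC
  let N : Matrix (Fin m) (Fin n) V := fun i j => A' i j + cfun p q (fun i => κ (α i)) y' i j
  have hN : ∀ i j, V.subtype (N i j) = c * ψ (bMat hs p q k α A₀ i j) := by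
    intro i j
    simp only [N, bMat, map_add, mul_add, map_cfun, mul_cfun]
    rfl
  let ρ := IsLocalRing.residue V
  have hres : ∀ i j, ρ (N i j) = cfun p q (fun i => ρ (κ (α i))) (fun a b => ρ (y' a b)) i j := by
    intro i j
    have : ρ (A' i j) = 0 := by
      rw [IsLocalRing.residue_eq_zero_iff, ValuationSubring.valuation_lt_one_iff]
      exact hA1 i j
    simp only [N, map_add, map_cfun, this, zero_add]
  have hq : 0 < q := by
    rcases Nat.eq_zero_or_pos q with h0 | h0
    · rw [h0, mul_zero] at hpq; omega
    · exact h0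
  have hy1 : y' (j₀ / q) (j₀ % q) = 1 := by
    apply Subtype.ext
    change c * ψ (yCoef K hs q k _ _) = 1
    have e1 : (j₀ : ℕ) / q * q + j₀ % q = j₀ := Nat.div_add_mod' _ _
    have : yCoef K hs q k (j₀ / q) (j₀ % q) = MvPowerSeries.X j₀ ^ (k + 1) := by
      unfold yCoef
      rw [dif_pos (by omega)]
      congr 2
      exact Fin.ext e1
    rw [this, map_pow, ← hx₀, hc]
    exact inv_mul_cancel₀ (pow_ne_zero _ hx0)
  obtain ⟨f, g, hdet⟩ := exists_minor_ne_zero hm hn (fun i => ρ (κ (α i)))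
    (fun a b hab => hα ((ρ.comp κ).injective hab)) (fun a b => ρ (y' a b)) (j₀ / q) (j₀ % q)
    (by rw [Nat.div_lt_iff_lt_mul hq]; omega) (Nat.mod_lt _ hq)
    (by rw [hy1, map_one]; exact one_ne_zero)
  apply hdet
  have h1 : (Matrix.of fun i j => cfun p q (fun i => ρ (κ (α i))) (fun a b => ρ (y' a b))
      (f i) (g j)) = ρ.mapMatrix (N.submatrix f g) := by
    ext i j
    simp only [Matrix.of_apply, RingHom.mapMatrix_apply, Matrix.map_apply, Matrix.submatrix_apply,
      hres]
  have h2 : (N.submatrix f g).det = 0 := by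
    apply V.subtype_injective
    rw [map_zero, RingHom.map_det]
    have : V.subtype.mapMatrix (N.submatrix f g) =
        c • ψ.mapMatrix ((bMat hs p q k α A₀).submatrix f g) := by
      ext i j
      simp only [RingHom.mapMatrix_apply, Matrix.map_apply, Matrix.submatrix_apply, hN,
        Matrix.smul_apply, smul_eq_mul]
    rw [this, Matrix.det_smul, ← RingHom.map_det, hB, mul_zero]
  rw [h1, ← RingHom.map_det, h2, map_zero]

lemma le_height_bMat {s h m n p q k t : ℕ} (hs : h ≤ s) (hpq : h ≤ p * q) (hm : p + t = m + 1)
    (hn : q + t = n + 1) (α : ℕ → K) (hα : Function.Injective α)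
    (A₀ : Matrix (Fin m) (Fin n) (MvPowerSeries (Fin s) K)) (hA₀ : ∀ i j, IsPolyLe k (A₀ i j))
    (P : Ideal (MvPowerSeries (Fin s) K)) [P.IsPrime]
    (hP : detIdeal t (bMat hs p q k α A₀) ≤ P) : (h : ℕ∞) ≤ P.height := by
  refine le_height_of_integral K h s hs P fun j hj => ?_
  let L := FractionRing (MvPowerSeries (Fin s) K ⧸ P)
  let ψ : MvPowerSeries (Fin s) K →+* L :=
    (algebraMap (MvPowerSeries (Fin s) K ⧸ P) L).comp (Ideal.Quotient.mk P)
  have hψ : ∀ r, ψ r = 0 ↔ r ∈ P := fun r => by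
    rw [← Ideal.Quotient.eq_zero_iff_mem]
    exact IsFractionRing.to_map_eq_zero_iff (R := MvPowerSeries (Fin s) K ⧸ P) (K := L)
  let η := ψ.comp (thetaHom K s h)
  have hmem : ψ (MvPowerSeries.X j) ∈
      (integralClosure (Subring.closure (η.range : Set L)) L).toSubring := by
    rw [← iInf_valuationSubring_superset, Subring.mem_iInf]
    rintro ⟨V, hV⟩
    refine mem_valuationSubring V hs hpq hm hn α hα A₀ hA₀ ψ (fun c => ?_) (fun i hi => ?_)
      (fun f g => (hψ _).mpr (hP (det_mem_detIdeal _ f g))) j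
    · refine hV ⟨MvPolynomial.C c, ?_⟩
      simp [η, thetaHom]
    · refine hV ⟨MvPolynomial.X (i - h), ?_⟩
      have : h + (i - h : ℕ) = i := by omega
      simp [η, thetaHom, this]
  obtain ⟨r, hr, hr0⟩ : IsIntegral (Subring.closure (η.range : Set L)) (ψ (MvPowerSeries.X j)) :=
    hmem
  have hlift : r.map (algebraMap (Subring.closure (η.range : Set L)) L) ∈ Polynomial.lifts η := by
    rw [Polynomial.lifts_iff_coeff_lifts]
    intro i
    rw [Polynomial.coeff_map]
    exact (Subring.closure_eq η.range).le (r.coeff i).2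
  obtain ⟨Q, hQ, -, hQm⟩ := Polynomial.lifts_and_natDegree_eq_and_monic hlift (hr.map _)
  refine ⟨Q, hQm, ?_⟩
  rw [← hψ, Polynomial.hom_eval₂]
  change Polynomial.eval₂ η _ Q = 0
  rw [← Polynomial.eval_map, hQ, Polynomial.eval_map]
  exact hr0

end LowerBound

/-- If `K` is infinite and `A ∈ 𝔪·Mat(m,n,R)`, `n ≤ m`, is finitely `G`-determined,
then for every `t ∈ {1,…,n}` the determinantal ideal `I_t(A)` has the maximal
height `min {s, (m−t+1)(n−t+1)}`. -/
theorem height_detIdeal_of_finitelyGDetermined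
    {s : ℕ} {K : Type*} [Field K] [Infinite K] {m n : ℕ} (hnm : n ≤ m)
    (A : Matrix (Fin m) (Fin n) (MvPowerSeries (Fin s) K))
    (hA : ∀ i j, A i j ∈ mIdeal s K)
    (hdet : FinitelyGDetermined A) :
    ∀ t : ℕ, 1 ≤ t → t ≤ n →
      idealHeight (detIdeal t A) = (min s ((m - t + 1) * (n - t + 1)) : ℕ∞) := by
  intro t ht htn
  have hcast : (min s ((m - t + 1) * (n - t + 1)) : ℕ∞) =
      ((min s ((m - t + 1) * (n - t + 1)) : ℕ) : ℕ∞) := by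
    rfl
  rw [hcast]
  have hle : detIdeal t A ≤ mIdeal s K := by
    rw [detIdeal_le_iff]
    intro f g
    rw [Matrix.det_apply]
    refine Ideal.sum_mem _ fun σ _ => ?_
    rw [Units.smul_def, zsmul_eq_mul]
    refine Ideal.mul_mem_left _ _ ?_
    exact Ideal.prod_mem (i := (⟨0, ht⟩ : Fin t)) _ (Finset.mem_univ _) (hA _ _)
  apply le_antisymm
  · have hub : ∀ p : Ideal (MvPowerSeries (Fin s) K), p.IsPrime → detIdeal t A ≤ p →
        idealHeight (detIdeal t A) ≤ p.height := by
      intro p hp hle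
      have := iInf₂_le (f := fun (p : PrimeSpectrum (MvPowerSeries (Fin s) K))
        (_ : detIdeal t A ≤ p.asIdeal) => Order.height p) ⟨p, hp⟩ hle
      rw [← PrimeSpectrum.height_eq_orderHeight] at this
      exact this
    rw [(Nat.mono_cast (α := ℕ∞)).map_min]
    refine le_min ?_ ?_
    · refine (hub _ (mIdeal_isPrime s) hle).trans ?_
      have hmin : mIdeal s K ∈
          (Ideal.span (Set.range (MvPowerSeries.X : Fin s → MvPowerSeries (Fin s) K))).minimalPrimes :=
        ⟨⟨mIdeal_isPrime s, le_rfl⟩, fun q hq _ => hq.2⟩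
      refine (Ideal.height_le_card_of_mem_minimalPrimes_span (Set.finite_range _) hmin).trans ?_
      norm_cast
      rw [← Set.image_univ]
      refine (Set.ncard_image_le Set.finite_univ).trans ?_
      simp [Set.ncard_univ]
    · obtain ⟨p, hp⟩ := Ideal.nonempty_minimalPrimes
        (ne_top_of_le_ne_top (mIdeal_isPrime (K := K) s).ne_top hle)
      exact (hub p hp.1.1 hp.1.2).trans (eagonNorthcott ht htn (htn.trans hnm) A p hp)
  · obtain ⟨k, hk⟩ := hdet
    choose A₀ hA₀ hA₁ using fun i j => exists_trunc k (A i j)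
    set h := min s ((m - t + 1) * (n - t + 1)) with hh
    have hs : h ≤ s := min_le_left _ _
    let α := Infinite.natEmbedding K
    let B := bMat hs (m - t + 1) (n - t + 1) k α (A₀ : Matrix (Fin m) (Fin n) _)
    obtain ⟨U, V, φ, -, -, hB⟩ := hk B (fun i j => by
      have : B i j - A i j = (A₀ i j - A i j) + cfun (m - t + 1) (n - t + 1)
        (fun i => MvPowerSeries.C (α i)) (yCoef K hs (n - t + 1) k) i j := by
        simp only [B, bMat]; ring
      rw [this]
      exact Ideal.add_mem _ (hA₁ i j) (cfun_mem _ _ _ _ _ (yCoef_mem hs _ k) _ _))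
    have hIB : detIdeal t B ≤ (detIdeal t A).map (φ : MvPowerSeries (Fin s) K →+* _) := by
      rw [← detIdeal_map, hB]
      exact (detIdeal_mul_right_le _ _).trans (detIdeal_mul_left_le _ _)
    refine le_iInf₂ fun p hp => ?_
    rw [← PrimeSpectrum.height_eq_orderHeight]
    let e : MvPowerSeries (Fin s) K ≃+* MvPowerSeries (Fin s) K := φ.toRingEquiv
    have hP : (p.asIdeal.comap e.symm).IsPrime := Ideal.comap_isPrime _ _
    rw [← RingEquiv.height_comap e.symm p.asIdeal]
    refine le_height_bMat hs (min_le_right _ _) (by omega) (by omega) α α.injective A₀ hA₀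
      (p.asIdeal.comap e.symm) (hIB.trans ?_)
    rw [Ideal.map_le_iff_le_comap]
    intro x hx
    change e.symm (e x) ∈ p.asIdeal
    rw [RingEquiv.symm_apply_apply]
    exact hp hx

end
end

section
/- Let K be any field and A ∈ 𝔪·Mat(m,n,R) a matrix that is finitely G-determined. If s ≥ mn, then height(I_1(A)) = mn; equivalently, the mn entries of A form a regular sequence in R. -/
noncomputable section

namespace CMAux

universe u

open IsLocalRing RingTheory.Sequence Pointwise

theorem coheight_of_assoc {R : Type u} [CommRing R] [IsNoetherianRing R] [IsLocalRing R]
    (rs : List R) : ∀ (M : Type u) [AddCommGroup M] [Module R M] [Module.Finite R M]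
    (_ : ∀ r ∈ rs, r ∈ maximalIdeal R) (_ : IsRegular M rs) (P : PrimeSpectrum R)
    (_ : IsAssociatedPrime P.asIdeal M), (rs.length : ℕ∞) ≤ Order.coheight P := by
  induction rs with
  | nil => intros; simp
  | cons x rs ih =>
    intro M _ _ _ hmem hreg P hP
    rw [isRegular_cons_iff] at hreg
    obtain ⟨hx, hreg⟩ := hreg
    -- the submodule killed by `P`
    obtain ⟨-, m₀, hm₀⟩ := isAssociatedPrime_iff.mp hP
    let N : Submodule R M :=
      { carrier := {m | ∀ p ∈ P.asIdeal, p • m = 0}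
        add_mem' := by
          intro a b ha hb p hp
          rw [smul_add, ha p hp, hb p hp, add_zero]
        zero_mem' := by intro p _; simp
        smul_mem' := by
          intro c a ha p hp
          rw [smul_comm, ha p hp, smul_zero] }
    have hm₀N : m₀ ∈ N := by
      intro p hp
      rw [hm₀, Submodule.mem_colon_singleton] at hp
      simpa using hp
    have hm₀0 : m₀ ≠ 0 := by
      rintro rfl
      apply P.2.ne_top
      rw [hm₀, Ideal.eq_top_iff_one, Submodule.mem_colon_singleton]
      simp
    have hxm : x ∈ maximalIdeal R := hmem x (by simp)
    have hNx : ¬ N ≤ x • (⊤ : Submodule R M) := by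
      intro hle
      have h1 : N ≤ (maximalIdeal R) • N := by
        intro y hy
        obtain ⟨z, -, hz⟩ := hle hy
        have hz : x • z = y := hz
        have hzN : z ∈ N := by
          intro p hp
          have := hy p hp
          rw [← hz, smul_comm] at this
          exact hx.right_eq_zero_of_smul this
        rw [← hz]
        exact Submodule.smul_mem_smul hxm hzN
      have h2 : N = ⊥ := Submodule.eq_bot_of_le_smul_of_le_jacobson_bot _ _
        (IsNoetherian.noetherian N) h1 (by rw [jacobson_eq_maximalIdeal _ bot_ne_top])
      rw [h2] at hm₀N
      exact hm₀0 (by simpa using hm₀N)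
    obtain ⟨y, hyN, hyx⟩ := Set.not_subset.mp hNx
    let yb : QuotSMulTop x M := Submodule.Quotient.mk y
    have hyb : yb ≠ 0 := by
      intro h
      exact hyx ((Submodule.Quotient.mk_eq_zero _).mp h)
    obtain ⟨Q, hQ, hle⟩ := exists_le_isAssociatedPrime_of_isNoetherianRing R yb hyb
    have hxQ : x ∈ Q := by
      apply hle
      rw [Submodule.mem_colon_singleton, Submodule.mem_bot]
      change Submodule.Quotient.mk (x • y) = 0
      rw [Submodule.Quotient.mk_eq_zero]
      exact Submodule.smul_mem_pointwise_smul _ _ _ trivial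
    have hPQ : P.asIdeal ≤ Q := by
      intro p hp
      apply hle
      rw [Submodule.mem_colon_singleton, Submodule.mem_bot]
      change Submodule.Quotient.mk (p • y) = 0
      rw [hyN p hp]; rfl
    have hxP : x ∉ P.asIdeal := by
      intro hxP
      exact hm₀0 (hx.right_eq_zero_of_smul (hm₀N x hxP))
    have hlt : P < ⟨Q, hQ.isPrime⟩ := by
      refine lt_of_le_of_ne hPQ ?_
      intro h
      apply hxP
      rw [h]; exact hxQ
    have := ih (QuotSMulTop x M) (fun r hr => hmem r (by simp [hr])) hreg ⟨Q, hQ.isPrime⟩ hQ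
    calc ((x :: rs).length : ℕ∞) = rs.length + 1 := by simp
      _ ≤ Order.coheight (⟨Q, hQ.isPrime⟩ : PrimeSpectrum R) + 1 := by gcongr
      _ ≤ _ := Order.coheight_add_one_le hlt

theorem coheight_le {R : Type u} [CommRing R] [IsNoetherianRing R] [IsLocalRing R]
    (P : PrimeSpectrum R) (fs : List R) (hfs : ∀ f ∈ fs, f ∈ maximalIdeal R)
    (h : ∀ Q : Ideal R, Q.IsPrime → P.asIdeal ≤ Q → Ideal.ofList fs ≤ Q → Q = maximalIdeal R) :
    Order.coheight P ≤ fs.length := by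
  classical
  let S := R ⧸ P.asIdeal
  have h1 : (Order.coheight P : WithBot ℕ∞) ≤ ringKrullDim S := by
    rw [ringKrullDim_quotient, Order.coheight_eq_krullDim_Ici]
    have : PrimeSpectrum.zeroLocus (P.asIdeal : Set R) = Set.Ici P := by
      ext Q; simp [PrimeSpectrum.mem_zeroLocus]
    rw [this]
  let π := Ideal.Quotient.mk P.asIdeal
  have hSn : Nontrivial S := Ideal.Quotient.nontrivial_iff.mpr P.2.ne_top
  have hSl : IsLocalRing S := IsLocalRing.of_surjective' π Ideal.Quotient.mk_surjective
  have h2 : (maximalIdeal S).height ≤ ((fs.map π).toFinset : Set S).ncard := by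
    apply Ideal.height_le_card_of_mem_minimalPrimes_span (Finset.finite_toSet _)
    have hloc : IsLocalHom π := .of_surjective _ Ideal.Quotient.mk_surjective
    refine ⟨⟨inferInstance, ?_⟩, ?_⟩
    · rw [Ideal.span_le]
      intro a ha
      simp only [List.coe_toFinset, List.mem_map, Set.mem_ofPred_eq] at ha
      obtain ⟨f, hf, rfl⟩ := ha
      exact ((local_hom_TFAE π).out 0 1 |>.mp hloc) |> fun _ => by
        have := hfs f hf
        rw [SetLike.mem_coe, mem_maximalIdeal, mem_nonunits_iff, isUnit_map_iff π]
        exact this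
    · rintro Q ⟨hQ, hQle⟩ -
      have := h (Q.comap π) inferInstance ?_ ?_
      · intro z hz
        obtain ⟨w, rfl⟩ := Ideal.Quotient.mk_surjective z
        rw [← Ideal.mem_comap, this]
        rw [mem_maximalIdeal, mem_nonunits_iff, isUnit_map_iff π] at hz
        exact hz
      · intro p hp
        rw [Ideal.mem_comap, Ideal.Quotient.eq_zero_iff_mem.mpr hp]
        exact zero_mem _
      · rw [Ideal.ofList, Ideal.span_le]
        intro f hf
        apply hQle
        apply Ideal.subset_span
        simp only [List.coe_toFinset, List.mem_map, Set.mem_ofPred_eq]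
        exact ⟨f, hf, rfl⟩
  have h3 : ((fs.map π).toFinset : Set S).ncard ≤ fs.length := by
    rw [Set.ncard_coe_finset]
    exact (List.toFinset_card_le _).trans (by simp)
  rw [← maximalIdeal_height_eq_ringKrullDim] at h1
  have h4 : Order.coheight P ≤ (maximalIdeal S).height := by exact_mod_cast h1
  exact h4.trans (h2.trans (by exact_mod_cast h3))

open CategoryTheory Abelian ModuleCat in
theorem exists_regular_quot {R : Type u} [CommRing R] [IsNoetherianRing R] [IsLocalRing R]
    (M : Type u) [AddCommGroup M] [Module R M] [Module.Finite R M] [Nontrivial M] (d : ℕ) (x : R)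
    (hxm : x ∈ maximalIdeal R) (hx : IsSMulRegular M x)
    (h : ∃ rs : List R, rs.length = d + 1 ∧ (∀ r ∈ rs, r ∈ maximalIdeal R) ∧ IsRegular M rs) :
    ∃ rs : List R, rs.length = d ∧ (∀ r ∈ rs, r ∈ maximalIdeal R) ∧
      IsRegular (QuotSMulTop x M) rs := by
  have key : ∀ (L : Type u) [AddCommGroup L] [Module R L] [Module.Finite R L] [Nontrivial L],
      maximalIdeal R • (⊤ : Submodule R L) < ⊤ := by
    intro L _ _ _ _
    rw [lt_top_iff_ne_top, ne_comm]
    refine Submodule.top_ne_ideal_smul_of_le_jacobson_annihilator ?_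
    rw [jacobson_eq_maximalIdeal]
    rw [Ne, ← Submodule.annihilator_top, Submodule.annihilator_eq_top_iff]
    exact top_ne_bot
  have : Nontrivial (QuotSMulTop x M) := nontrivial_quotSMulTop_of_mem_maximalIdeal M hxm
  have h1 := ((exists_isRegular_tfae (maximalIdeal R) (d+1) (ModuleCat.of R M) (key M)).out 3 1).mp h
  refine ((exists_isRegular_tfae (maximalIdeal R) d (ModuleCat.of R (QuotSMulTop x M))
    (key _)).out 1 3).mp ?_
  intro i hi
  have zero1 := AddCommGrpCat.isZero_of_iff_subsingleton.mpr (h1 i (by omega))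
  have zero2 := AddCommGrpCat.isZero_of_iff_subsingleton.mpr (h1 (i + 1) (by omega))
  exact AddCommGrpCat.subsingleton_of_isZero <| ShortComplex.Exact.isZero_of_both_zeros
    ((Ext.covariant_sequence_exact₃' _
      (IsSMulRegular.smulShortComplex_shortExact (M := ModuleCat.of R M) hx)) i (i + 1) rfl)
    (zero1.eq_zero_of_src _) (zero2.eq_zero_of_tgt _)

theorem cm {R : Type u} [CommRing R] [IsNoetherianRing R] [IsLocalRing R]
    (fs : List R) : ∀ (M : Type u) [AddCommGroup M] [Module R M] [Module.Finite R M] [Nontrivial M]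
    (_ : ∀ f ∈ fs, f ∈ maximalIdeal R)
    (_ : ∃ rs : List R, rs.length = fs.length ∧ (∀ r ∈ rs, r ∈ maximalIdeal R) ∧ IsRegular M rs)
    (_ : ∀ Q : Ideal R, Q.IsPrime → Module.annihilator R M ≤ Q → Ideal.ofList fs ≤ Q →
      Q = maximalIdeal R), IsWeaklyRegular M fs := by
  induction fs with
  | nil => intros; simp
  | cons f fs ih =>
    intro M _ _ _ _ hfs hrs hQ
    have hfm : f ∈ maximalIdeal R := hfs f (by simp)
    have hf : IsSMulRegular M f := by
      by_contra hf
      have : f ∈ ⋃ p ∈ associatedPrimes R M, (p : Set R) := by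
        rw [biUnion_associatedPrimes_eq_compl_regular]; exact hf
      simp only [Set.mem_iUnion] at this
      obtain ⟨P, hP, hfP⟩ := this
      obtain ⟨rs, hlen, hrm, hreg⟩ := hrs
      have h1 := coheight_of_assoc rs M hrm hreg ⟨P, hP.isPrime⟩ hP
      have h2 := coheight_le ⟨P, hP.isPrime⟩ fs (fun r hr => hfs r (by simp [hr])) (by
        intro Q hQp hPQ hfQ
        refine hQ Q hQp ?_ ?_
        · refine le_trans ?_ hPQ
          have := hP.annihilator_le
          rwa [Submodule.annihilator_top] at this
        · rw [Ideal.ofList_cons]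
          refine sup_le ?_ hfQ
          rw [Ideal.span_singleton_le_iff_mem]
          exact hPQ hfP)
      have h3 := h1.trans h2
      rw [hlen] at h3
      simp only [List.length_cons] at h3
      have : fs.length + 1 ≤ fs.length := by exact_mod_cast h3
      omega
    rw [isWeaklyRegular_cons_iff]
    refine ⟨hf, ?_⟩
    have : Nontrivial (QuotSMulTop f M) := nontrivial_quotSMulTop_of_mem_maximalIdeal M hfm
    refine ih (QuotSMulTop f M) (fun r hr => hfs r (by simp [hr])) ?_ ?_
    · exact exists_regular_quot M fs.length f hfm hf (by simpa using hrs)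
    · intro Q hQp hann hfQ
      refine hQ Q hQp ?_ ?_
      · refine le_trans ?_ hann
        exact LinearMap.annihilator_le_of_surjective _ (Submodule.mkQ_surjective _)
      · rw [Ideal.ofList_cons]
        refine sup_le ?_ hfQ
        rw [Ideal.span_singleton_le_iff_mem]
        apply hann
        rw [Module.mem_annihilator]
        intro m
        obtain ⟨y, rfl⟩ := Submodule.mkQ_surjective _ m
        change Submodule.Quotient.mk (f • y) = 0
        rw [Submodule.Quotient.mk_eq_zero]
        exact Submodule.smul_mem_pointwise_smul _ _ _ trivial

/-- prime avoidance for cosets -/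
theorem coset_avoid {R : Type u} [CommRing R] (T : Finset (Ideal R)) (hT : ∀ P ∈ T, P.IsPrime)
    (hinc : ∀ P ∈ T, ∀ Q ∈ T, P ≤ Q → P = Q) (I : Ideal R) (hI : ∀ P ∈ T, ¬ I ≤ P) (a : R) :
    ∃ y ∈ I, ∀ P ∈ T, a + y ∉ P := by
  classical
  obtain ⟨T1, hT1⟩ : ∃ T1 : Finset (Ideal R), ∀ P, P ∈ T1 ↔ P ∈ T ∧ a ∉ P :=
    ⟨T.filter (fun P => a ∉ P), fun P => Finset.mem_filter⟩
  obtain ⟨T2, hT2⟩ : ∃ T1 : Finset (Ideal R), ∀ P, P ∈ T1 ↔ P ∈ T ∧ a ∈ P :=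
    ⟨T.filter (fun P => a ∈ P), fun P => Finset.mem_filter⟩
  have hp : ∀ P ∈ T2, P ≠ ⊤ → P ≠ ⊤ → P.IsPrime :=
    fun P hP _ _ => hT P ((hT2 P).mp hP).1
  have h : ¬ (((I * ∏ P ∈ T1, P : Ideal R) : Set R) ⊆
      ⋃ P ∈ (↑T2 : Set (Ideal R)), (P : Set R)) := by
    intro hsub
    obtain ⟨P, hP, hle⟩ := (Ideal.subset_union_prime (f := fun P : Ideal R => P) ⊤ ⊤ hp).mp hsub
    rw [hT2] at hP
    have hPp := hT P hP.1
    rcases hPp.mul_le.mp hle with h1 | h1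
    · exact hI P hP.1 h1
    · rw [hPp.prod_le] at h1
      obtain ⟨Q, hQ, hQP⟩ := h1
      rw [hT1] at hQ
      have hQP' := hinc Q hQ.1 P hP.1 hQP
      rw [hQP'] at hQ
      exact hQ.2 hP.2
  obtain ⟨y, hy, hy'⟩ := Set.not_subset.mp h
  have hyI : y ∈ I := Ideal.mul_le_left hy
  refine ⟨y, hyI, fun P hP hmem => ?_⟩
  by_cases haP : a ∈ P
  · apply hy'
    simp only [Set.mem_iUnion]
    refine ⟨P, (hT2 P).mpr ⟨hP, haP⟩, ?_⟩
    exact (Submodule.add_mem_iff_right P haP).mp hmem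
  · have hPf : P ∈ T1 := (hT1 P).mpr ⟨hP, haP⟩
    have h1 : (∏ P ∈ T1, P) ≤ P :=
      (Ideal.prod_le_inf (f := fun P : Ideal R => P)).trans
        (Finset.inf_le (f := fun P : Ideal R => P) hPf)
    have : y ∈ P := h1 (Ideal.mul_le_right hy)
    exact haP ((Submodule.add_mem_iff_left P this).mp hmem)

theorem exists_seq {R : Type u} [CommRing R] [IsNoetherianRing R] [IsLocalRing R] (s : ℕ)
    (hs : (s : ℕ∞) ≤ (maximalIdeal R).height) (a : ℕ → R) (k : ℕ) :
    ∀ t ≤ s, ∃ b : ℕ → R, (∀ i, b i - a i ∈ maximalIdeal R ^ k) ∧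
      ∀ i ≤ t, ∀ Q : Ideal R, Q.IsPrime → Ideal.span (b '' Set.Iio i) ≤ Q → (i : ℕ∞) ≤ Q.height := by
  classical
  intro t
  induction t with
  | zero =>
    intro _
    refine ⟨a, by simp, ?_⟩
    intro i hi Q _ _
    obtain rfl : i = 0 := by omega
    simp
  | succ t ih =>
    intro ht
    obtain ⟨b, hb, hh⟩ := ih (by omega)
    let J := Ideal.span (b '' Set.Iio t)
    have hfin : (J.minimalPrimes).Finite := Ideal.finite_minimalPrimes_of_isNoetherianRing R J
    obtain ⟨y, hy, hav⟩ := coset_avoid hfin.toFinset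
      (fun P hP => (hfin.mem_toFinset.mp hP).1.1)
      (fun P hP Q hQ hPQ => le_antisymm hPQ
        ((hfin.mem_toFinset.mp hQ).2 (hfin.mem_toFinset.mp hP).1 hPQ))
      (maximalIdeal R ^ k) (by
        intro P hP hle
        have hP := hfin.mem_toFinset.mp hP
        have hPp : P.IsPrime := hP.1.1
        have hmP : maximalIdeal R ≤ P := hPp.le_of_pow_le hle
        have h1 : P.height ≤ (b '' Set.Iio t).ncard :=
          Ideal.height_le_card_of_mem_minimalPrimes_span ((Set.finite_Iio t).image b) hP
        have h2 : (b '' Set.Iio t).ncard ≤ t := by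
          refine (Set.ncard_image_le (Set.finite_Iio t)).trans ?_
          simp
        have h3 : (s : ℕ∞) ≤ t := hs.trans ((Ideal.height_mono hmP).trans (h1.trans (by exact_mod_cast h2)))
        have : s ≤ t := by exact_mod_cast h3
        omega) (a t)
    have himg : ∀ i ≤ t, Function.update b t (a t + y) '' Set.Iio i = b '' Set.Iio i := by
      intro i hi
      apply Set.image_congr
      intro j hj
      have : j ≠ t := by have := Set.mem_Iio.mp hj; omega
      simp [this]
    refine ⟨Function.update b t (a t + y), ?_, ?_⟩
    · intro i
      by_cases hi : i = t
      · subst hi; simpa using hy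
      · simpa [hi] using hb i
    · intro i hi Q hQ hle
      rcases Nat.lt_or_ge t i with hlt | hge
      · obtain rfl : i = t + 1 := by omega
        have hJQ : J ≤ Q := by
          refine le_trans ?_ hle
          change Ideal.span (b '' Set.Iio t) ≤ _
          rw [← himg t le_rfl]
          exact Ideal.span_mono (Set.image_mono (Set.Iio_subset_Iio (by omega)))
        obtain ⟨P, hP, hPQ⟩ := Ideal.exists_minimalPrimes_le hJQ
        have hPp : P.IsPrime := hP.1.1
        have hQt : a t + y ∈ Q := by
          apply hle
          apply Ideal.subset_span
          exact ⟨t, by simp, by simp⟩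
        have hne : P < Q := by
          refine lt_of_le_of_ne hPQ ?_
          rintro rfl
          exact hav P (hfin.mem_toFinset.mpr hP) hQt
        calc ((t + 1 : ℕ) : ℕ∞) = t + 1 := by simp
          _ ≤ P.height + 1 := by gcongr; exact hh t le_rfl P hPp hP.1.2
          _ ≤ Q.height := Ideal.height_add_one_le_of_lt_of_isPrime hne
      · rw [himg i hge] at hle
        exact hh i hge Q hQ hle
end CMAux

namespace CMAux

open IsLocalRing RingTheory.Sequence

theorem mem_span_X {σ K : Type*} [Field K] (S : Finset σ) (f : MvPowerSeries σ K) :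
    f ∈ Ideal.span ((MvPowerSeries.X : σ → MvPowerSeries σ K) '' (S : Set σ)) ↔
      ∀ d : σ →₀ ℕ, (∀ j ∈ S, d j = 0) → MvPowerSeries.coeff d f = 0 := by
  classical
  constructor
  · intro hf
    induction hf using Submodule.span_induction with
    | mem x hx =>
      obtain ⟨j, hj, rfl⟩ := hx
      intro d hd
      exact MvPowerSeries.X_dvd_iff.mp dvd_rfl d (hd j hj)
    | zero => simp
    | add x y _ _ hx hy =>
      intro d hd
      rw [map_add, hx d hd, hy d hd, add_zero]
    | smul r x _ hx =>
      intro d hd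
      rw [smul_eq_mul, MvPowerSeries.coeff_mul]
      apply Finset.sum_eq_zero
      rintro ⟨u, v⟩ huv
      rw [Finset.HasAntidiagonal.mem_antidiagonal] at huv
      rw [hx v, mul_zero]
      intro j hj
      have h1 := hd j hj
      rw [← huv] at h1
      simp only [Finsupp.add_apply] at h1
      omega
  · induction S using Finset.induction_on generalizing f with
    | empty =>
      intro h
      have : f = 0 := by
        ext d
        simpa using h d (by simp)
      rw [this]; exact zero_mem _
    | insert j S hj ih =>
      intro h
      let g : MvPowerSeries σ K := fun d => if d j = 0 then 0 else MvPowerSeries.coeff d f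
      have hg : ∀ d, MvPowerSeries.coeff d g = if d j = 0 then 0 else MvPowerSeries.coeff d f :=
        fun d => rfl
      have h1 : MvPowerSeries.X j ∣ g := by
        rw [MvPowerSeries.X_dvd_iff]
        intro d hd
        rw [hg, if_pos hd]
      have h2 : f - g ∈ Ideal.span
          ((MvPowerSeries.X : σ → MvPowerSeries σ K) '' (S : Set σ)) := by
        apply ih
        intro d hd
        rw [map_sub, hg]
        split_ifs with hdj
        · rw [h d, sub_zero]
          intro i hi
          rcases Finset.mem_insert.mp hi with rfl | hi
          · exact hdj
          · exact hd i hi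
        · rw [sub_self]
      have h3 : f = (f - g) + g := by ring
      rw [h3]
      refine add_mem (Ideal.span_mono (Set.image_mono (by simp)) h2) ?_
      exact Ideal.mem_of_dvd _ h1 (Ideal.subset_span ⟨j, by simp, rfl⟩)

theorem mIdeal_eq (s : ℕ) (K : Type*) [Field K] :
    mIdeal s K = maximalIdeal (MvPowerSeries (Fin s) K) := by
  ext f
  have h := mem_span_X (Finset.univ) f
  rw [Finset.coe_univ, Set.image_univ] at h
  rw [mIdeal, h, mem_maximalIdeal, mem_nonunits_iff, MvPowerSeries.isUnit_iff_constantCoeff,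
    isUnit_iff_ne_zero, not_not]
  constructor
  · intro h
    exact h 0 (by simp)
  · intro h d hd
    have : d = 0 := by ext j; exact hd j (by simp)
    rw [this]; exact h

theorem X_regular (s : ℕ) (K : Type*) [Field K] :
    IsRegular (MvPowerSeries (Fin s) K)
      (List.ofFn (MvPowerSeries.X : Fin s → MvPowerSeries (Fin s) K)) := by
  rw [IsLocalRing.isRegular_iff_isWeaklyRegular_of_subset_maximalIdeal]
  · rw [isWeaklyRegular_iff]
    intro i hi
    have hi' : i < s := by simpa using hi
    have hspan : Ideal.ofList ((List.ofFn
        (MvPowerSeries.X : Fin s → MvPowerSeries (Fin s) K)).take i) =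
        Ideal.span ((MvPowerSeries.X : Fin s → MvPowerSeries (Fin s) K) ''
          ((Finset.univ.filter (fun j : Fin s => j.val < i) : Finset (Fin s)) : Set (Fin s))) := by
      rw [Ideal.ofList]
      congr 1
      ext g
      simp only [Set.mem_ofPred_eq, List.mem_take_iff_getElem, Set.mem_image]
      constructor
      · rintro ⟨j, hj, rfl⟩
        have : j < s := by simp at hj; omega
        refine ⟨⟨j, this⟩, ?_, by simp⟩
        simp at hj ⊢
        omega
      · rintro ⟨j, hj, rfl⟩
        refine ⟨j, ?_, by simp⟩
        simp at hj ⊢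
        omega
    rw [isSMulRegular_quotient_iff_mem_of_smul_mem]
    intro f hf
    rw [hspan] at hf ⊢
    simp only [smul_eq_mul, Ideal.mul_top, List.getElem_ofFn] at hf ⊢
    rw [mem_span_X] at hf ⊢
    intro d hd
    have := hf (Finsupp.single ⟨i, hi'⟩ 1 + d) (by
      intro j hj
      have hne : (⟨i, hi'⟩ : Fin s) ≠ j := by
        rintro rfl
        simp at hj
      rw [Finsupp.add_apply, Finsupp.single_eq_of_ne' hne, hd j hj])
    rwa [MvPowerSeries.X, MvPowerSeries.coeff_add_monomial_mul, one_mul] at this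
  · intro r hr
    rw [List.mem_ofFn] at hr
    obtain ⟨j, rfl⟩ := hr
    rw [← mIdeal_eq]
    exact Ideal.subset_span ⟨j, rfl⟩

theorem height_max (s : ℕ) (K : Type*) [Field K] :
    (s : ℕ∞) ≤ (maximalIdeal (MvPowerSeries (Fin s) K)).height := by
  have h := ringKrullDim_add_length_eq_ringKrullDim_of_isRegular _ (X_regular s K)
  have h0 : 0 ≤ ringKrullDim (MvPowerSeries (Fin s) K ⧸ Ideal.ofList
      (List.ofFn (MvPowerSeries.X : Fin s → MvPowerSeries (Fin s) K))) := by
    have : Nontrivial (MvPowerSeries (Fin s) K ⧸ Ideal.ofList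
      (List.ofFn (MvPowerSeries.X : Fin s → MvPowerSeries (Fin s) K))) := by
      rw [Ideal.Quotient.nontrivial_iff]
      have := (X_regular s K).top_ne_smul
      intro h
      rw [h] at this
      simp at this
    exact ringKrullDim_nonneg_of_nontrivial
  have h1 : (s : WithBot ℕ∞) ≤ ((maximalIdeal (MvPowerSeries (Fin s) K)).height : WithBot ℕ∞) := by
    rw [maximalIdeal_height_eq_ringKrullDim, ← h, List.length_ofFn]
    exact le_add_of_nonneg_left h0
  exact_mod_cast h1

theorem idealHeight_eq {A : Type*} [CommRing A] (I : Ideal A) : idealHeight I = I.height := by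
  rw [Ideal.height_eq_inf_minimalPrimes, idealHeight]
  apply le_antisymm
  · refine le_iInf₂ fun J hJ => ?_
    have hJp : J.IsPrime := hJ.1.1
    refine (iInf₂_le (⟨J, hJp⟩ : PrimeSpectrum A) hJ.1.2).trans ?_
    rw [← PrimeSpectrum.height_eq_orderHeight]
  · refine le_iInf₂ fun p hp => ?_
    obtain ⟨J, hJ, hJp⟩ := Ideal.exists_minimalPrimes_le hp
    refine (iInf₂_le J hJ).trans ?_
    rw [← PrimeSpectrum.height_eq_orderHeight]
    exact Ideal.height_mono hJp

theorem detIdeal_one {A : Type*} [CommRing A] {m n : ℕ} (M : Matrix (Fin m) (Fin n) A) :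
    detIdeal 1 M = Ideal.span (Set.range fun p : Fin m × Fin n => M p.1 p.2) := by
  rw [detIdeal]
  congr 1
  ext d
  constructor
  · rintro ⟨f, g, rfl⟩
    exact ⟨(f 0, g 0), by simp⟩
  · rintro ⟨⟨i, j⟩, rfl⟩
    exact ⟨fun _ => i, fun _ => j, by simp⟩

theorem entries_mul_le {A : Type*} [CommRing A] {m n : ℕ} (M : Matrix (Fin m) (Fin n) A)
    (U : Matrix (Fin m) (Fin m) A) (V : Matrix (Fin n) (Fin n) A) :
    detIdeal 1 (U * M * V) ≤ detIdeal 1 M := by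
  rw [detIdeal_one, detIdeal_one, Ideal.span_le]
  rintro _ ⟨⟨i, j⟩, rfl⟩
  simp only [Matrix.mul_apply]
  refine Ideal.sum_mem _ fun l _ => Ideal.mul_mem_right _ _ (Ideal.sum_mem _ fun k _ =>
    Ideal.mul_mem_left _ _ (Ideal.subset_span ⟨(k, l), rfl⟩))

theorem entries_mul_eq {A : Type*} [CommRing A] {m n : ℕ} (M : Matrix (Fin m) (Fin n) A)
    (U : Matrix (Fin m) (Fin m) A) (V : Matrix (Fin n) (Fin n) A) (hU : IsUnit U)
    (hV : IsUnit V) :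
    detIdeal 1 (U * M * V) = detIdeal 1 M := by
  apply le_antisymm (entries_mul_le M U V)
  obtain ⟨U', hU'⟩ := hU.exists_left_inv
  obtain ⟨V', hV'⟩ := hV.exists_right_inv
  have : M = U' * (U * M * V) * V' := by
    calc M = (U' * U) * M * (V * V') := by rw [hU', hV', Matrix.one_mul, Matrix.mul_one]
      _ = _ := by simp only [Matrix.mul_assoc]
  conv_lhs => rw [this]
  exact entries_mul_le _ _ _

end CMAux

/-- If `A ∈ 𝔪·Mat(m,n,R)` is finitely `G`-determined (over any field `K`) and
`s ≥ mn`, then `height I_1(A) = mn`; equivalently, the `mn` entries of `A` form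
a regular sequence in `R`. -/
theorem height_entryIdeal_of_finitelyGDetermined
    {s : ℕ} {K : Type*} [Field K] {m n : ℕ}
    (A : Matrix (Fin m) (Fin n) (MvPowerSeries (Fin s) K))
    (hA : ∀ i j, A i j ∈ mIdeal s K)
    (hdet : FinitelyGDetermined A) (hs : m * n ≤ s) :
    idealHeight (detIdeal 1 A) = (m * n : ℕ∞) ∧
      RingTheory.Sequence.IsRegular (MvPowerSeries (Fin s) K)
        (List.ofFn fun p : Fin (m * n) =>
          A (finProdFinEquiv.symm p).1 (finProdFinEquiv.symm p).2) := by
  classical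
  obtain ⟨k, hk⟩ := hdet
  -- the entries of `A` as a sequence
  let a : ℕ → MvPowerSeries (Fin s) K := fun p =>
    if h : p < m * n then
      A (finProdFinEquiv.symm ⟨p, h⟩).1 (finProdFinEquiv.symm ⟨p, h⟩).2 else 0
  have ha : ∀ p : Fin (m * n), a p = A (finProdFinEquiv.symm p).1 (finProdFinEquiv.symm p).2 := by
    intro p
    simp only [a, dif_pos p.2]
  obtain ⟨b, hb, hbh⟩ := CMAux.exists_seq s (CMAux.height_max s K) a (k + 1) s le_rfl
  let B : Matrix (Fin m) (Fin n) (MvPowerSeries (Fin s) K) :=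
    fun i j => b (finProdFinEquiv (i, j))
  obtain ⟨U, V, φ, hU, hV, hB⟩ := hk B (by
    intro i j
    have h1 := hb (finProdFinEquiv (i, j))
    rw [ha, Equiv.symm_apply_apply] at h1
    rw [CMAux.mIdeal_eq]
    exact h1)
  have hIB : detIdeal 1 B = Ideal.span (b '' Set.Iio (m * n)) := by
    rw [CMAux.detIdeal_one]
    congr 1
    ext d
    constructor
    · rintro ⟨p, rfl⟩
      exact ⟨finProdFinEquiv p, (finProdFinEquiv p).2, rfl⟩
    · rintro ⟨q, hq, rfl⟩
      refine ⟨finProdFinEquiv.symm ⟨q, hq⟩, ?_⟩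
      simp [B, Nat.mod_add_div]
  have hIA : detIdeal 1 B = (detIdeal 1 A).map φ.toRingEquiv := by
    rw [hB, CMAux.entries_mul_eq _ U V hU hV, CMAux.detIdeal_one, CMAux.detIdeal_one,
      Ideal.map_span, ← Set.range_comp]
    rfl
  have hAm : detIdeal 1 A ≤ IsLocalRing.maximalIdeal (MvPowerSeries (Fin s) K) := by
    rw [CMAux.detIdeal_one, Ideal.span_le]
    rintro _ ⟨p, rfl⟩
    rw [← CMAux.mIdeal_eq]
    exact hA p.1 p.2
  have hbm : ∀ i, b i ∈ IsLocalRing.maximalIdeal (MvPowerSeries (Fin s) K) := by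
    intro i
    have h1 : b i - a i ∈ IsLocalRing.maximalIdeal (MvPowerSeries (Fin s) K) :=
      Ideal.pow_le_self (by omega) (hb i)
    have h2 : a i ∈ IsLocalRing.maximalIdeal (MvPowerSeries (Fin s) K) := by
      simp only [a]
      split_ifs
      · rw [← CMAux.mIdeal_eq]; exact hA _ _
      · exact zero_mem _
    have := add_mem h1 h2
    rwa [sub_add_cancel] at this
  have hφm : ∀ x, φ.symm x ∈ IsLocalRing.maximalIdeal (MvPowerSeries (Fin s) K) ↔
      x ∈ IsLocalRing.maximalIdeal (MvPowerSeries (Fin s) K) := by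
    intro x
    rw [IsLocalRing.mem_maximalIdeal, IsLocalRing.mem_maximalIdeal, mem_nonunits_iff,
      mem_nonunits_iff, MulEquiv.isUnit_map φ.symm]
  constructor
  · rw [CMAux.idealHeight_eq]
    apply le_antisymm
    · obtain ⟨P, hP, -⟩ := Ideal.exists_minimalPrimes_le hAm
      have h1 : (detIdeal 1 A).height ≤ P.height := Ideal.height_mono hP.1.2
      rw [CMAux.detIdeal_one] at hP
      have h2 := Ideal.height_le_card_of_mem_minimalPrimes_span (Set.finite_range _) hP
      refine h1.trans (h2.trans ?_)
      have h3 : (Set.range fun p : Fin m × Fin n => A p.1 p.2).ncard ≤ m * n := by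
        rw [← Set.image_univ]
        refine (Set.ncard_image_le Set.finite_univ).trans ?_
        simp [Set.ncard_univ]
      exact_mod_cast h3
    · have h1 : (detIdeal 1 A).height = (detIdeal 1 B).height := by
        rw [hIA]
        exact (RingEquiv.height_map φ.toRingEquiv _).symm
      rw [h1, hIB, Ideal.height_eq_inf_minimalPrimes]
      refine le_iInf₂ fun Q hQ => ?_
      have := hbh (m * n) hs Q hQ.1.1 hQ.1.2
      exact_mod_cast this
  · set L := List.ofFn fun p : Fin (m * n) =>
      A (finProdFinEquiv.symm p).1 (finProdFinEquiv.symm p).2 with hL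
    have hLm : ∀ r ∈ L, r ∈ IsLocalRing.maximalIdeal (MvPowerSeries (Fin s) K) := by
      intro r hr
      rw [hL, List.mem_ofFn] at hr
      obtain ⟨p, rfl⟩ := hr
      rw [← CMAux.mIdeal_eq]
      exact hA _ _
    rw [IsLocalRing.isRegular_iff_isWeaklyRegular_of_subset_maximalIdeal hLm]
    let C := List.ofFn fun j : Fin (s - m * n) => φ.symm (b (m * n + j))
    have hCm : ∀ r ∈ C, r ∈ IsLocalRing.maximalIdeal (MvPowerSeries (Fin s) K) := by
      intro r hr
      rw [List.mem_ofFn] at hr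
      obtain ⟨p, rfl⟩ := hr
      rw [hφm]
      exact hbm _
    suffices h : RingTheory.Sequence.IsWeaklyRegular (MvPowerSeries (Fin s) K) (L ++ C) from
      ((RingTheory.Sequence.isWeaklyRegular_append_iff _ L C).mp h).1
    apply CMAux.cm
    · intro f hf
      rcases List.mem_append.mp hf with h | h
      · exact hLm f h
      · exact hCm f h
    · refine ⟨_, ?_, ?_, CMAux.X_regular s K⟩
      · simp [L, C]; omega
      · intro r hr
        rw [List.mem_ofFn] at hr
        obtain ⟨j, rfl⟩ := hr
        rw [← CMAux.mIdeal_eq]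
        exact Ideal.subset_span ⟨j, rfl⟩
    · intro Q hQp _ hQ
      -- transport by the automorphism
      have hLQ : ∀ r ∈ L ++ C, r ∈ Q := fun r hr => hQ (Ideal.subset_span hr)
      have hAQ : detIdeal 1 A ≤ Q := by
        rw [CMAux.detIdeal_one, Ideal.span_le]
        rintro _ ⟨p, rfl⟩
        apply hLQ
        apply List.mem_append_left
        rw [hL, List.mem_ofFn]
        exact ⟨finProdFinEquiv p, by simp⟩
      have hQ' : (Q.comap φ.symm.toRingEquiv).IsPrime := inferInstance
      have h1 : Ideal.span (b '' Set.Iio s) ≤ Q.comap φ.symm.toRingEquiv := by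
        rw [Ideal.span_le]
        rintro _ ⟨i, hi, rfl⟩
        have hi : i < s := hi
        by_cases hlt : i < m * n
        · have h2 : b i ∈ detIdeal 1 B := by
            rw [hIB]; exact Ideal.subset_span ⟨i, hlt, rfl⟩
          rw [hIA] at h2
          have h3 : (detIdeal 1 A).map φ.toRingEquiv ≤ Q.comap φ.symm.toRingEquiv := by
            rw [Ideal.map_le_iff_le_comap]
            intro x hx
            have := hAQ hx
            simpa [Ideal.mem_comap] using this
          exact h3 h2
        · have h2 : φ.symm (b i) ∈ Q := by
            apply hLQ
            apply List.mem_append_right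
            rw [List.mem_ofFn]
            refine ⟨⟨i - m * n, by omega⟩, ?_⟩
            have : m * n + (i - m * n) = i := by omega
            simp [this]
          exact h2
      have h2 := hbh s le_rfl _ hQ' h1
      have h3 : (Q.comap φ.symm.toRingEquiv).height = Q.height :=
        RingEquiv.height_comap φ.symm.toRingEquiv Q
      rw [h3] at h2
      have hle : Q ≤ IsLocalRing.maximalIdeal _ := IsLocalRing.le_maximalIdeal hQp.ne_top
      have h4 := Ideal.height_le_card_of_mem_minimalPrimes_span
        (p := IsLocalRing.maximalIdeal (MvPowerSeries (Fin s) K))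
        (s := Set.range (MvPowerSeries.X : Fin s → MvPowerSeries (Fin s) K))
        (Set.finite_range _) (by
          have : Ideal.span (Set.range (MvPowerSeries.X : Fin s → MvPowerSeries (Fin s) K)) =
            IsLocalRing.maximalIdeal _ := CMAux.mIdeal_eq s K
          rw [this, Ideal.minimalPrimes_eq_subsingleton_self]
          exact rfl)
      have h5 : (Set.range (MvPowerSeries.X : Fin s → MvPowerSeries (Fin s) K)).ncard ≤ s := by
        rw [← Set.image_univ]
        refine (Set.ncard_image_le Set.finite_univ).trans ?_
        simp [Set.ncard_univ]
      have h6 : (IsLocalRing.maximalIdeal (MvPowerSeries (Fin s) K)).height ≤ Q.height :=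
        (h4.trans (by exact_mod_cast h5)).trans h2
      exact Ideal.eq_of_le_of_height_le Q hle h6

end
end

section
/- Let K be any field and A ∈ 𝔪·Mat(m,n,R) a matrix that is finitely G-determined. If s ≤ mn, then the ideal I_1(A) generated by the entries of A contains 𝔪^k for some positive integer k; i.e., the entries of A generate an 𝔪-primary ideal of R. -/
noncomputable section

theorem coset_avoid {S : Type*} [CommRing S] (I : Ideal S) (a : S) (T : Finset (Ideal S)) :
    (∀ P ∈ T, P.IsPrime) → (∀ P ∈ T, ¬ I ≤ P) →
    (∀ P ∈ T, ∀ Q ∈ T, P ≤ Q → P = Q) →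
    ∃ c ∈ I, ∀ P ∈ T, a + c ∉ P := by
  classical
  induction T using Finset.induction_on with
  | empty => intro _ _ _; exact ⟨0, I.zero_mem, by simp⟩
  | insert Q T hQ ih =>
    intro hp hI hanti
    obtain ⟨c, hc, hcT⟩ := ih (fun P h => hp P (Finset.mem_insert_of_mem h))
      (fun P h => hI P (Finset.mem_insert_of_mem h))
      (fun P h P' h' => hanti P (Finset.mem_insert_of_mem h) P' (Finset.mem_insert_of_mem h'))
    by_cases hcQ : a + c ∈ Q
    · have hQp : Q.IsPrime := hp Q (Finset.mem_insert_self _ _)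
      have hnot : ¬ (I * ∏ P ∈ T, P) ≤ Q := by
        intro hle
        rcases hQp.mul_le.1 hle with h | h
        · exact hI Q (Finset.mem_insert_self _ _) h
        · obtain ⟨P, hPT, hPQ⟩ := (Ideal.IsPrime.prod_le hQp).1 h
          have := hanti P (Finset.mem_insert_of_mem hPT) Q (Finset.mem_insert_self _ _) hPQ
          exact hQ (this ▸ hPT)
      obtain ⟨d, hd, hdQ⟩ := SetLike.not_le_iff_exists.1 hnot
      have hd1 : d ∈ I := (Ideal.mul_le_left : I * (∏ P ∈ T, P) ≤ I) hd
      have hd2 : d ∈ ∏ P ∈ T, P := (Ideal.mul_le_right : I * (∏ P ∈ T, P) ≤ ∏ P ∈ T, P) hd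
      refine ⟨c + d, I.add_mem hc hd1, ?_⟩
      intro P hP
      rcases Finset.mem_insert.1 hP with rfl | hP
      · intro h
        rw [← add_assoc] at h
        exact hdQ ((P.add_mem_iff_right hcQ).1 h)
      · intro h
        rw [← add_assoc] at h
        have hle1 : (∏ P ∈ T, P) ≤ T.inf (fun P => P) := Ideal.prod_le_inf
        have hle2 : T.inf (fun P => P) ≤ P := Finset.inf_le (f := fun P : Ideal S => P) hP
        have hdP : d ∈ P := hle2 (hle1 hd2)
        exact hcT P hP ((P.add_mem_iff_left hdP).1 h)
    · refine ⟨c, hc, fun P hP => ?_⟩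
      rcases Finset.mem_insert.1 hP with rfl | hP
      · exact hcQ
      · exact hcT P hP

theorem exists_perturb {S : Type*} [CommRing S] [IsNoetherianRing S] [IsLocalRing S]
    {ι : Type*} [DecidableEq ι] (a : ι → S) (k : ℕ) (T : Finset ι) :
    ∃ b : ι → S, (∀ i, b i - a i ∈ IsLocalRing.maximalIdeal S ^ (k + 1)) ∧
      ∀ P : Ideal S, P.IsPrime → (∀ i ∈ T, b i ∈ P) →
        P = IsLocalRing.maximalIdeal S ∨ (T.card : ℕ∞) ≤ P.height := by
  classical
  induction T using Finset.induction_on with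
  | empty => exact ⟨a, by simp, fun P _ _ => Or.inr (by simp)⟩
  | insert t T ht ih =>
    obtain ⟨b, hb, hbP⟩ := ih
    set I : Ideal S := Ideal.span (b '' T) with hI
    have hfin : I.minimalPrimes.Finite := Ideal.finite_minimalPrimes_of_isNoetherianRing S I
    obtain ⟨c, hc, hcP⟩ := coset_avoid (IsLocalRing.maximalIdeal S ^ (k + 1)) (a t)
      (hfin.toFinset.filter (fun P => P ≠ IsLocalRing.maximalIdeal S))
      (by
        intro P hP
        simp only [Finset.mem_filter, Set.Finite.mem_toFinset] at hP
        exact hP.1.1.1)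
      (by
        intro P hP hle
        simp only [Finset.mem_filter, Set.Finite.mem_toFinset] at hP
        have hPp : P.IsPrime := hP.1.1.1
        have := hPp.le_of_pow_le hle
        exact hP.2 ((IsLocalRing.maximalIdeal.isMaximal S).eq_of_le hPp.ne_top this).symm)
      (by
        intro P hP Q hQ hle
        simp only [Finset.mem_filter, Set.Finite.mem_toFinset] at hP hQ
        exact le_antisymm hle (hQ.1.2 hP.1.1 hle))
    refine ⟨Function.update b t (a t + c), ?_, ?_⟩
    · intro i
      by_cases h : i = t
      · subst h; simpa using hc
      · simpa [Function.update_of_ne h] using hb i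
    · intro P hP hmem
      have hIP : I ≤ P := by
        rw [hI, Ideal.span_le]
        rintro _ ⟨i, hi, rfl⟩
        have h := hmem i (Finset.mem_insert_of_mem hi)
        have hit : i ≠ t := fun h => ht (h ▸ hi)
        rwa [Function.update_of_ne hit] at h
      have htP : a t + c ∈ P := by
        simpa using hmem t (Finset.mem_insert_self _ _)
      obtain ⟨Q, hQ, hQP⟩ := Ideal.exists_minimalPrimes_le hIP
      have hQp : Q.IsPrime := hQ.1.1
      by_cases hQm : Q = IsLocalRing.maximalIdeal S
      · left
        exact ((IsLocalRing.maximalIdeal.isMaximal S).eq_of_le hP.ne_top (hQm ▸ hQP)).symm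
      · right
        have htQ : a t + c ∉ Q := hcP Q (by simp [hQ, hQm])
        have hlt : Q < P := lt_of_le_of_ne hQP (fun h => htQ (h ▸ htP))
        have hQh := (hbP Q hQp (fun i hi =>
          hQ.1.2 (Ideal.subset_span ⟨i, hi, rfl⟩))).resolve_left hQm
        rw [Finset.card_insert_of_notMem ht]
        push_cast
        exact (add_le_add_left hQh 1).trans (Ideal.height_add_one_le_of_lt_of_isPrime hlt)

theorem mem_mIdeal_of_constantCoeff {K : Type*} [Field K] (s : ℕ) :
    ∀ f : MvPowerSeries (Fin s) K, MvPowerSeries.constantCoeff f = 0 → f ∈ mIdeal s K := by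
  induction s with
  | zero =>
    intro f hf
    have : f = 0 := by
      ext d
      rw [Subsingleton.elim d 0]
      simpa using hf
    rw [this]; exact Ideal.zero_mem _
  | succ n ih =>
    intro f hf
    set E := MvPowerSeries.finSuccEquiv K n
    have h0 : PowerSeries.constantCoeff (E f) ∈ mIdeal n K := by
      apply ih
      have := MvPowerSeries.coeff_coeff_finSuccEquiv (R := K) f (k := 0) (x := 0)
      simpa [E, hf] using this
    have hmap : ∀ g ∈ mIdeal n K, E.symm (PowerSeries.C g) ∈ mIdeal (n + 1) K := by
      intro g hg
      have : mIdeal n K ≤ (mIdeal (n + 1) K).comap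
          ((E.symm : _ →+* MvPowerSeries (Fin (n + 1)) K).comp PowerSeries.C) := by
        rw [mIdeal, Ideal.span_le]
        rintro _ ⟨j, rfl⟩
        have : E.symm (PowerSeries.C (MvPowerSeries.X j)) = MvPowerSeries.X j.succ := by
          rw [AlgEquiv.symm_apply_eq]
          exact (MvPowerSeries.finSuccEquiv_X_succ ..).symm
        change E.symm (PowerSeries.C (MvPowerSeries.X j)) ∈ mIdeal (n + 1) K
        rw [this]
        exact Ideal.subset_span ⟨_, rfl⟩
      exact this hg
    have hdec := PowerSeries.eq_X_mul_shift_add_const (E f)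
    have hX : E.symm PowerSeries.X = MvPowerSeries.X 0 := by
      rw [AlgEquiv.symm_apply_eq]
      exact (MvPowerSeries.finSuccEquiv_X_zero ..).symm
    have hf' : f = E.symm (E f) := by simp
    rw [hf', hdec, map_add, map_mul, hX]
    exact Ideal.add_mem _ (Ideal.mul_mem_right _ _ (Ideal.subset_span ⟨_, rfl⟩)) (hmap _ h0)

theorem mIdeal_eq {K : Type*} [Field K] (s : ℕ) :
    mIdeal s K = IsLocalRing.maximalIdeal (MvPowerSeries (Fin s) K) := by
  apply le_antisymm
  · rw [mIdeal, Ideal.span_le]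
    rintro _ ⟨j, rfl⟩
    change MvPowerSeries.X j ∈ IsLocalRing.maximalIdeal _
    rw [IsLocalRing.mem_maximalIdeal, mem_nonunits_iff, MvPowerSeries.isUnit_iff_constantCoeff]
    simp
  · intro f hf
    apply mem_mIdeal_of_constantCoeff
    rw [IsLocalRing.mem_maximalIdeal, mem_nonunits_iff, MvPowerSeries.isUnit_iff_constantCoeff] at hf
    simpa using hf

theorem height_mIdeal_le {K : Type*} [Field K] (s : ℕ) :
    (mIdeal s K).height ≤ s := by
  have hp : (mIdeal s K).IsPrime := by rw [mIdeal_eq]; infer_instance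
  have hmin : mIdeal s K ∈
      (Ideal.span (Set.range (MvPowerSeries.X : Fin s → MvPowerSeries (Fin s) K))).minimalPrimes :=
    ⟨⟨hp, le_rfl⟩, fun Q hQ _ => hQ.2⟩
  refine (Ideal.height_le_card_of_mem_minimalPrimes_span (Set.finite_range _) hmin).trans ?_
  have := Set.ncard_image_le (f := (MvPowerSeries.X : Fin s → MvPowerSeries (Fin s) K))
    (Set.finite_univ)
  rw [Set.image_univ, Set.ncard_univ, Nat.card_fin] at this
  exact_mod_cast this

/-- If `A ∈ 𝔪·Mat(m,n,R)` is finitely `G`-determined (over any field `K`) and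
`s ≤ mn`, then `I_1(A) ⊇ 𝔪^k` for some positive `k`, i.e. the entries of `A`
generate an `𝔪`-primary ideal of `R`. -/
theorem entryIdeal_primary_of_finitelyGDetermined
    {s : ℕ} {K : Type*} [Field K] {m n : ℕ}
    (A : Matrix (Fin m) (Fin n) (MvPowerSeries (Fin s) K))
    (hA : ∀ i j, A i j ∈ mIdeal s K)
    (hdet : FinitelyGDetermined A) (hs : s ≤ m * n) :
    ∃ k : ℕ, 0 < k ∧ (mIdeal s K) ^ k ≤ detIdeal 1 A := by
  classical
  obtain ⟨k, hk⟩ := hdet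
  obtain ⟨b, hb, hbP⟩ := exists_perturb (fun p : Fin m × Fin n => A p.1 p.2) k Finset.univ
  have hGE := hk (Matrix.of fun i j => b (i, j)) (by
    intro i j
    rw [mIdeal_eq]
    exact hb (i, j))
  obtain ⟨U, V, φ, -, -, hB⟩ := hGE
  have hrad : mIdeal s K ≤ (Ideal.span (Set.range b)).radical := by
    rw [Ideal.radical_eq_sInf]
    refine le_sInf ?_
    rintro P ⟨hle, hP⟩
    have hPm : P ≤ mIdeal s K := by
      rw [mIdeal_eq]; exact IsLocalRing.le_maximalIdeal hP.ne_top
    rcases hbP P hP (fun i _ => hle (Ideal.subset_span ⟨i, rfl⟩)) with h | h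
    · rw [h, mIdeal_eq]
    · refine (Ideal.eq_of_le_of_height_le _ hPm ((height_mIdeal_le s).trans (le_trans ?_ h))).ge
      simpa using (by exact_mod_cast hs : (s : ℕ∞) ≤ ((m * n : ℕ) : ℕ∞))
  obtain ⟨N, hN⟩ := Ideal.exists_pow_le_of_le_radical_of_fg hrad (IsNoetherian.noetherian _)
  have hφm : mIdeal s K ≤ (mIdeal s K).comap φ := by
    intro x hx
    rw [Ideal.mem_comap]
    rw [mIdeal_eq, IsLocalRing.mem_maximalIdeal, mem_nonunits_iff] at hx ⊢
    rwa [MulEquiv.isUnit_map φ]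
  have hent : ∀ i j, A i j ∈ detIdeal 1 A := fun i j =>
    Ideal.subset_span ⟨fun _ => i, fun _ => j, by simp⟩
  have hspan : Ideal.span (Set.range b) ≤ (detIdeal 1 A).comap φ.symm := by
    rw [Ideal.span_le]
    rintro _ ⟨⟨i, j⟩, rfl⟩
    have h : b (i, j) = (U * (A.map φ) * V) i j := by rw [← hB]; rfl
    change φ.symm (b (i, j)) ∈ detIdeal 1 A
    rw [h, Matrix.mul_apply, map_sum]
    refine Ideal.sum_mem _ fun l _ => ?_
    rw [map_mul]
    refine Ideal.mul_mem_right _ _ ?_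
    rw [Matrix.mul_apply, map_sum]
    refine Ideal.sum_mem _ fun l' _ => ?_
    rw [map_mul]
    refine Ideal.mul_mem_left _ _ ?_
    simpa using hent l' l
  refine ⟨N + 1, Nat.succ_pos _, ?_⟩
  intro x hx
  have hx' : x ∈ mIdeal s K ^ N := Ideal.pow_le_pow_right (Nat.le_succ N) hx
  have h1 : φ x ∈ mIdeal s K ^ N :=
    Ideal.le_comap_pow (φ : MvPowerSeries (Fin s) K →+* MvPowerSeries (Fin s) K) N
      (Ideal.pow_right_mono hφm N hx')
  have h2 : φ.symm (φ x) ∈ detIdeal 1 A := hspan (hN h1)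
  simpa using h2

end
end
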